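/- In F_q((T^{-1})), the Koksma-type classification coincides with the Mahler-type classification: the classes A, S, T, U defined via w_n coincide respectively with the classes A*, S*, T*, U* defined via w_n^*. Equivalently, for every ξ ∈ F_q((T^{-1})) and every n ≥ 1, w_n(ξ) is finite if and only if w_n^*(ξ) is finite, and w(ξ) := limsup w_n(ξ)/n is zero (resp. positive finite, resp. infinite) exactly when w*(ξ) := limsup w_n^*(ξ)/n is. -/

import Mathlib

open Polynomial
open scoped Classical

namespace MahlerKoksmaFq

noncomputable section

variable (Fq : Type) [Field Fq] [Fintype Fq]

/-- `K Fq` models `F_q((T⁻¹))`: Laurent series in the variable `t = T⁻¹`. -/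
abbrev K := LaurentSeries Fq

/-- The element `T` (the inverse of the Laurent-series variable `t = T⁻¹`). -/
def Tvar : K Fq := HahnSeries.single (-1 : ℤ) 1

/-- The absolute value `|ξ| = q^{-ν(ξ)}` on `F_q((T⁻¹))`. -/
def absK (ξ : K Fq) : ℝ :=
  if ξ = 0 then 0 else (Fintype.card Fq : ℝ) ^ (-(HahnSeries.order ξ))

/-- The embedding of `F_q[T]` into `F_q((T⁻¹))`, sending `T` to `Tvar`. -/
def emb : Polynomial Fq →+* K Fq :=
  Polynomial.eval₂RingHom (algebraMap Fq (K Fq)) (Tvar Fq)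

/-- Evaluation of `P ∈ F_q[T][X]` at `ξ ∈ F_q((T⁻¹))`. -/
def evalK (P : Polynomial (Polynomial Fq)) (ξ : K Fq) : K Fq :=
  P.eval₂ (emb Fq) ξ

/-- Height of a polynomial over `F_q[T]`: the maximum of the absolute values
`q^{deg c}` of its coefficients. -/
def HP (P : Polynomial (Polynomial Fq)) : ℝ :=
  (Fintype.card Fq : ℝ) ^ (P.support.sup fun i => (P.coeff i).natDegree)

/-- `ξ` is algebraic (over `F_q[T]`) of degree at most `n`. -/
def IsAlgDegLe (ξ : K Fq) (n : ℕ) : Prop :=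
  ∃ P : Polynomial (Polynomial Fq), P ≠ 0 ∧ P.natDegree ≤ n ∧ evalK Fq P ξ = 0

/-- `ξ` is algebraic over `F_q[T]`. -/
def IsAlgK (ξ : K Fq) : Prop :=
  ∃ P : Polynomial (Polynomial Fq), P ≠ 0 ∧ evalK Fq P ξ = 0

/-- The degree of an algebraic element of `F_q((T⁻¹))`. -/
def degA (α : K Fq) : ℕ :=
  sInf {d | ∃ P : Polynomial (Polynomial Fq), P ≠ 0 ∧ P.natDegree = d ∧ evalK Fq P α = 0}

/-- The height of an algebraic element `α` of `F_q((T⁻¹))`: the least height of a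
 nonzero annihilating polynomial of minimal degree (= height of the minimal
 defining polynomial over `F_q[T]`). -/
def HA (α : K Fq) : ℝ :=
  sInf {h | ∃ P : Polynomial (Polynomial Fq),
    P ≠ 0 ∧ P.natDegree = degA Fq α ∧ evalK Fq P α = 0 ∧ h = HP Fq P}

/-- The defining set for Mahler's exponent `w_n`. -/
def wnSet (ξ : K Fq) (n : ℕ) : Set ℝ :=
  {w | {P : Polynomial (Polynomial Fq) |
      P.natDegree ≤ n ∧ 0 < absK Fq (evalK Fq P ξ) ∧
      absK Fq (evalK Fq P ξ) < HP Fq P ^ (-w)}.Infinite}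

/-- Mahler's exponent `w_n(ξ)`. -/
def wn (ξ : K Fq) (n : ℕ) : EReal :=
  sSup ((fun w : ℝ => (w : EReal)) '' wnSet Fq ξ n)

/-- The defining set for `w_n^{sep}` (separable polynomials only). -/
def wnsepSet (ξ : K Fq) (n : ℕ) : Set ℝ :=
  {w | {P : Polynomial (Polynomial Fq) |
      P.Separable ∧ P.natDegree ≤ n ∧ 0 < absK Fq (evalK Fq P ξ) ∧
      absK Fq (evalK Fq P ξ) < HP Fq P ^ (-w)}.Infinite}

/-- The exponent `w_n^{sep}(ξ)`. -/
def wnsep (ξ : K Fq) (n : ℕ) : EReal :=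
  sSup ((fun w : ℝ => (w : EReal)) '' wnsepSet Fq ξ n)

/-- The defining set for Koksma's exponent `w_n^*` (approximation by algebraic
elements lying in `F_q((T⁻¹))`). -/
def wnstarSet (ξ : K Fq) (n : ℕ) : Set ℝ :=
  {w | {α : K Fq | IsAlgK Fq α ∧ degA Fq α ≤ n ∧ 0 < absK Fq (ξ - α) ∧
      absK Fq (ξ - α) < HA Fq α ^ (-w - 1)}.Infinite}

/-- Koksma's exponent `w_n^*(ξ)`. -/
def wnstar (ξ : K Fq) (n : ℕ) : EReal :=
  sSup ((fun w : ℝ => (w : EReal)) '' wnstarSet Fq ξ n)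

/-- The defining set for the uniform exponent `ŵ_n`. -/
def hwnSet (ξ : K Fq) (n : ℕ) : Set ℝ :=
  {w | ∃ H0 : ℝ, ∀ H : ℝ, H0 < H → ∃ P : Polynomial (Polynomial Fq),
      P.natDegree ≤ n ∧ HP Fq P ≤ H ∧ 0 < absK Fq (evalK Fq P ξ) ∧
      absK Fq (evalK Fq P ξ) < H ^ (-w)}

/-- The uniform exponent `ŵ_n(ξ)`. -/
def hwn (ξ : K Fq) (n : ℕ) : EReal :=
  sSup ((fun w : ℝ => (w : EReal)) '' hwnSet Fq ξ n)

/-- The defining set for the uniform exponent `ŵ_n^{sep}` (separable polynomials only). -/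
def hwnsepSet (ξ : K Fq) (n : ℕ) : Set ℝ :=
  {w | ∃ H0 : ℝ, ∀ H : ℝ, H0 < H → ∃ P : Polynomial (Polynomial Fq),
      P.Separable ∧ P.natDegree ≤ n ∧ HP Fq P ≤ H ∧ 0 < absK Fq (evalK Fq P ξ) ∧
      absK Fq (evalK Fq P ξ) < H ^ (-w)}

/-- The uniform exponent `ŵ_n^{sep}(ξ)`. -/
def hwnsep (ξ : K Fq) (n : ℕ) : EReal :=
  sSup ((fun w : ℝ => (w : EReal)) '' hwnsepSet Fq ξ n)

/-- The fractional part of a Laurent series in `T⁻¹`: the part with only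
 negative powers of `T` (positive powers of the series variable `t = T⁻¹`). -/
def fracPart (η : K Fq) : K Fq :=
  { coeff := fun m => if 0 < m then η.coeff m else 0
    isPWO_support' := η.isPWO_support'.mono (fun m hm => by
      by_cases h : 0 < m
      · simpa [Function.mem_support, h] using hm
      · simp [Function.mem_support, h] at hm) }

/-- The fractional-part norm `‖η‖ = |η - [η]|`. -/
def fracNorm (η : K Fq) : ℝ := absK Fq (fracPart Fq η)

/-- `max{‖R(T)ξ‖, …, ‖R(T)ξⁿ‖}`. -/
def maxFrac (ξ : K Fq) (n : ℕ) (R : Polynomial Fq) : ℝ :=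
  sSup ((fun i => fracNorm Fq (emb Fq R * ξ ^ i)) '' Set.Icc 1 n)

/-- The defining set for the exponent of simultaneous approximation `λ_n`. -/
def lamSet (ξ : K Fq) (n : ℕ) : Set ℝ :=
  {l | {R : Polynomial Fq | 0 < maxFrac Fq ξ n R ∧
      maxFrac Fq ξ n R < (Fintype.card Fq : ℝ) ^ (-(l * R.natDegree))}.Infinite}

/-- The exponent of simultaneous approximation `λ_n(ξ)`. -/
def lam (ξ : K Fq) (n : ℕ) : EReal :=
  sSup ((fun w : ℝ => (w : EReal)) '' lamSet Fq ξ n)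

/-- The defining set for the uniform exponent `λ̂_n`. -/
def hlamSet (ξ : K Fq) (n : ℕ) : Set ℝ :=
  {l | ∃ d0 : ℕ, ∀ d : ℕ, d0 < d → ∃ R : Polynomial Fq, R.natDegree ≤ d ∧
      0 < maxFrac Fq ξ n R ∧
      maxFrac Fq ξ n R < (Fintype.card Fq : ℝ) ^ (-(l * d))}

/-- The uniform exponent `λ̂_n(ξ)`. -/
def hlam (ξ : K Fq) (n : ℕ) : EReal :=
  sSup ((fun w : ℝ => (w : EReal)) '' hlamSet Fq ξ n)

/-- An algebraic closure of `F_q((T⁻¹))`; its algebraic elements are exactly the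
algebraic elements of the completion `C_∞`. -/
abbrev Kbar := AlgebraicClosure (K Fq)

/-- The embedding of `F_q[T]` into the algebraic closure. -/
def embbar : Polynomial Fq →+* Kbar Fq :=
  (algebraMap (K Fq) (Kbar Fq)).comp (emb Fq)

/-- Evaluation of `P ∈ F_q[T][X]` at a point of the algebraic closure. -/
def evalKbar (P : Polynomial (Polynomial Fq)) (x : Kbar Fq) : Kbar Fq :=
  P.eval₂ (embbar Fq) x

/-- The unique extension of the absolute value of `F_q((T⁻¹))` to its algebraic
closure: `|x| = |N(x)|^{1/d} = |a_0|^{1/d}` where `a_0` is the constant term and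
`d` the degree of the minimal polynomial of `x` over `F_q((T⁻¹))`. -/
def absC (x : Kbar Fq) : ℝ :=
  absK Fq ((minpoly (K Fq) x).coeff 0) ^ ((1 : ℝ) / (minpoly (K Fq) x).natDegree)

/-- `x ∈ C_∞` is algebraic over `F_q[T]`. -/
def IsAlgKbar (x : Kbar Fq) : Prop :=
  ∃ P : Polynomial (Polynomial Fq), P ≠ 0 ∧ evalKbar Fq P x = 0

/-- Degree over `F_q[T]` of an algebraic element of `C_∞`. -/
def degAbar (x : Kbar Fq) : ℕ :=
  sInf {d | ∃ P : Polynomial (Polynomial Fq), P ≠ 0 ∧ P.natDegree = d ∧ evalKbar Fq P x = 0}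

/-- Height of an algebraic element of `C_∞`. -/
def HAbar (x : Kbar Fq) : ℝ :=
  sInf {h | ∃ P : Polynomial (Polynomial Fq),
    P ≠ 0 ∧ P.natDegree = degAbar Fq x ∧ evalKbar Fq P x = 0 ∧ h = HP Fq P}

/-- The defining set for the exponent `w_n^@` (approximation by algebraic
elements of `C_∞`). -/
def wnAtSet (ξ : K Fq) (n : ℕ) : Set ℝ :=
  {w | {α : Kbar Fq | IsAlgKbar Fq α ∧ degAbar Fq α ≤ n ∧
      0 < absC Fq (algebraMap (K Fq) (Kbar Fq) ξ - α) ∧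
      absC Fq (algebraMap (K Fq) (Kbar Fq) ξ - α) < HAbar Fq α ^ (-w - 1)}.Infinite}

/-- The exponent `w_n^@(ξ)`. -/
def wnAt (ξ : K Fq) (n : ℕ) : EReal :=
  sSup ((fun w : ℝ => (w : EReal)) '' wnAtSet Fq ξ n)

/-- The defining set for the uniform exponent `ŵ_n^@`. -/
def hwnAtSet (ξ : K Fq) (n : ℕ) : Set ℝ :=
  {w | ∃ H0 : ℝ, ∀ H : ℝ, H0 < H → ∃ α : Kbar Fq, IsAlgKbar Fq α ∧ degAbar Fq α ≤ n ∧
      HAbar Fq α ≤ H ∧ 0 < absC Fq (algebraMap (K Fq) (Kbar Fq) ξ - α) ∧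
      absC Fq (algebraMap (K Fq) (Kbar Fq) ξ - α) < (HAbar Fq α)⁻¹ * H ^ (-w)}

/-- The uniform exponent `ŵ_n^@(ξ)`. -/
def hwnAt (ξ : K Fq) (n : ℕ) : EReal :=
  sSup ((fun w : ℝ => (w : EReal)) '' hwnAtSet Fq ξ n)

/-- `w(ξ) = limsup_n w_n(ξ)/n`. -/
def wlim (ξ : K Fq) : EReal :=
  Filter.atTop.limsup fun n : ℕ => wn Fq ξ n * (((n : ℝ)⁻¹ : ℝ) : EReal)

/-- `w^*(ξ) = limsup_n w_n^*(ξ)/n`. -/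
def wlimstar (ξ : K Fq) : EReal :=
  Filter.atTop.limsup fun n : ℕ => wnstar Fq ξ n * (((n : ℝ)⁻¹ : ℝ) : EReal)

/-- Height of a polynomial over `C_∞`: maximum of the absolute values of its
coefficients. -/
def HC (P : Polynomial (Kbar Fq)) : ℝ :=
  sSup ((fun i => absC Fq (P.coeff i)) '' Set.Iic P.natDegree)



section
variable {Fq}

set_option linter.unusedSectionVars false
/-! ### The absolute value -/

lemma one_lt_q : (1 : ℝ) < (Fintype.card Fq : ℝ) := by
  exact_mod_cast Fintype.one_lt_card

lemma q_pos : (0 : ℝ) < (Fintype.card Fq : ℝ) := lt_trans one_pos one_lt_q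

lemma absK_zero : absK Fq 0 = 0 := by simp [absK]

lemma absK_of_ne {x : K Fq} (hx : x ≠ 0) :
    absK Fq x = (Fintype.card Fq : ℝ) ^ (-(HahnSeries.order x)) := by simp [absK, hx]

lemma absK_pos {x : K Fq} (hx : x ≠ 0) : 0 < absK Fq x := by
  rw [absK_of_ne hx]; exact zpow_pos q_pos _

lemma absK_nonneg (x : K Fq) : 0 ≤ absK Fq x := by
  by_cases hx : x = 0
  · simp [hx, absK_zero]
  · exact (absK_pos hx).le

lemma absK_pos_iff {x : K Fq} : 0 < absK Fq x ↔ x ≠ 0 :=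
  ⟨fun h hx => by simp [hx, absK_zero] at h, absK_pos⟩

lemma absK_mul (x y : K Fq) : absK Fq (x * y) = absK Fq x * absK Fq y := by
  by_cases hx : x = 0
  · simp [hx, absK_zero]
  by_cases hy : y = 0
  · simp [hy, absK_zero]
  rw [absK_of_ne hx, absK_of_ne hy, absK_of_ne (mul_ne_zero hx hy),
    HahnSeries.order_mul hx hy, ← zpow_add₀ q_pos.ne']
  congr 1; ring

lemma absK_one : absK Fq (1 : K Fq) = 1 := by
  rw [absK_of_ne one_ne_zero]; simp

lemma absK_neg (x : K Fq) : absK Fq (-x) = absK Fq x := by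
  simp [absK, HahnSeries.order_neg]

lemma absK_sub_comm (x y : K Fq) : absK Fq (x - y) = absK Fq (y - x) := by
  rw [← absK_neg, neg_sub]

/-- `absK` as a monoid hom with zero. -/
def absHom (Fq : Type) [Field Fq] [Fintype Fq] : K Fq →*₀ ℝ where
  toFun := absK Fq
  map_zero' := absK_zero
  map_one' := absK_one
  map_mul' := absK_mul

lemma absK_pow (x : K Fq) (n : ℕ) : absK Fq (x ^ n) = absK Fq x ^ n :=
  map_pow (absHom Fq) x n

lemma absK_div (x y : K Fq) : absK Fq (x / y) = absK Fq x / absK Fq y :=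
  map_div₀ (absHom Fq) x y

lemma absK_inv (x : K Fq) : absK Fq (x⁻¹) = (absK Fq x)⁻¹ :=
  map_inv₀ (absHom Fq) x

lemma absK_prod {ι : Type*} (s : Finset ι) (f : ι → K Fq) :
    absK Fq (∏ i ∈ s, f i) = ∏ i ∈ s, absK Fq (f i) :=
  map_prod (absHom Fq) f s

lemma absK_add_le (x y : K Fq) : absK Fq (x + y) ≤ max (absK Fq x) (absK Fq y) := by
  by_cases hx : x = 0
  · simp [hx]
  by_cases hy : y = 0
  · simp [hy]
  by_cases hxy : x + y = 0
  · rw [hxy, absK_zero]; exact le_max_of_le_left (absK_nonneg x)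
  rw [absK_of_ne hx, absK_of_ne hy, absK_of_ne hxy]
  have h := HahnSeries.min_order_le_order_add hxy
  rcases min_le_iff.1 h with h | h
  · exact le_max_of_le_left (zpow_le_zpow_right₀ one_lt_q.le (by linarith))
  · exact le_max_of_le_right (zpow_le_zpow_right₀ one_lt_q.le (by linarith))

lemma absK_add_le_of {x y : K Fq} {B : ℝ} (hx : absK Fq x ≤ B) (hy : absK Fq y ≤ B) :
    absK Fq (x + y) ≤ B := (absK_add_le x y).trans (max_le hx hy)

lemma absK_sub_le_of {x y : K Fq} {B : ℝ} (hx : absK Fq x ≤ B) (hy : absK Fq y ≤ B) :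
    absK Fq (x - y) ≤ B := by
  rw [sub_eq_add_neg]; exact absK_add_le_of hx (by rwa [absK_neg])

lemma absK_add_eq_left {x y : K Fq} (h : absK Fq y < absK Fq x) :
    absK Fq (x + y) = absK Fq x := by
  apply le_antisymm
  · exact absK_add_le_of le_rfl h.le
  · have h2 := absK_add_le (x + y) (-y)
    rw [add_neg_cancel_right, absK_neg] at h2
    rcases le_max_iff.1 h2 with h3 | h3
    · exact h3
    · exact absurd h (not_lt.2 h3)

lemma absK_sum_le {ι : Type*} (s : Finset ι) (f : ι → K Fq) {B : ℝ} (hB : 0 ≤ B)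
    (h : ∀ i ∈ s, absK Fq (f i) ≤ B) : absK Fq (∑ i ∈ s, f i) ≤ B := by
  induction s using Finset.induction_on with
  | empty => simpa [absK_zero] using hB
  | insert a s ha ih =>
    rw [Finset.sum_insert ha]
    exact absK_add_le_of (h a (by simp)) (ih fun i hi => h i (by simp [hi]))

lemma absK_sum_lt {ι : Type*} (s : Finset ι) (f : ι → K Fq) {B : ℝ} (hB : 0 < B)
    (h : ∀ i ∈ s, absK Fq (f i) < B) : absK Fq (∑ i ∈ s, f i) < B := by
  induction s using Finset.induction_on with
  | empty => simpa [absK_zero] using hB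
  | insert a s ha ih =>
    rw [Finset.sum_insert ha]
    exact (absK_add_le _ _).trans_lt
      (max_lt (h a (by simp)) (ih fun i hi => h i (by simp [hi])))

lemma absK_le_zpow_iff (x : K Fq) (M : ℤ) :
    absK Fq x ≤ (Fintype.card Fq : ℝ) ^ (-M) ↔ ∀ m < M, x.coeff m = 0 := by
  by_cases hx : x = 0
  · simp [hx, absK_zero, (zpow_pos q_pos _).le]
  rw [absK_of_ne hx, zpow_le_zpow_iff_right₀ one_lt_q]
  constructor
  · intro h m hm
    exact HahnSeries.coeff_eq_zero_of_lt_order (by linarith)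
  · intro h
    by_contra hc
    exact (mt HahnSeries.coeff_order_eq_zero.1 hx) (h _ (by linarith))

lemma absK_lt_one_iff (x : K Fq) :
    absK Fq x ≤ (Fintype.card Fq : ℝ)⁻¹ ↔ absK Fq x < 1 := by
  constructor
  · intro h; exact h.trans_lt (inv_lt_one_of_one_lt₀ one_lt_q)
  · intro h
    by_cases hx : x = 0
    · simp [hx, absK_zero, q_pos.le]
    rw [absK_of_ne hx] at h ⊢
    rw [← zpow_zero (Fintype.card Fq : ℝ), zpow_lt_zpow_iff_right₀ one_lt_q] at h
    rw [← zpow_neg_one, zpow_le_zpow_iff_right₀ one_lt_q]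
    omega

lemma absK_Tvar : absK Fq (Tvar Fq) = (Fintype.card Fq : ℝ) := by
  have : (Tvar Fq) ≠ 0 := by simp [Tvar]
  rw [absK_of_ne this, Tvar, HahnSeries.order_single one_ne_zero]; simp

lemma Tvar_pow (k : ℕ) : Tvar Fq ^ k = HahnSeries.single (-(k : ℤ)) 1 := by
  simp [Tvar, HahnSeries.single_pow]

lemma emb_monomial (k : ℕ) (c : Fq) :
    emb Fq (monomial k c) = HahnSeries.single (-(k : ℤ)) c := by
  simp only [emb, coe_eval₂RingHom, eval₂_monomial, Tvar_pow]
  have hc : algebraMap Fq (K Fq) c = HahnSeries.C c := by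
    rw [HahnSeries.algebraMap_apply']
    exact HahnSeries.ofPowerSeries_C c
  rw [hc]
  simp [HahnSeries.C_apply]

lemma emb_coeff (a : Fq[X]) (k : ℕ) : (emb Fq a).coeff (-(k : ℤ)) = a.coeff k := by
  induction a using Polynomial.induction_on' with
  | add p q hp hq => simp [hp, hq]
  | monomial n c =>
    rw [emb_monomial, HahnSeries.coeff_single, coeff_monomial]
    by_cases h : n = k
    · simp [h]
    · rw [if_neg h, if_neg (by omega)]

lemma emb_coeff_pos (a : Fq[X]) (m : ℤ) (hm : 0 < m) : (emb Fq a).coeff m = 0 := by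
  induction a using Polynomial.induction_on' with
  | add p q hp hq => simp [hp, hq]
  | monomial n c =>
    rw [emb_monomial, HahnSeries.coeff_single, if_neg (by omega)]

lemma emb_injective : Function.Injective (emb Fq) := by
  rw [injective_iff_map_eq_zero]
  intro a ha
  ext k
  rw [← emb_coeff, ha]; simp

lemma emb_ne_zero {a : Fq[X]} (ha : a ≠ 0) : emb Fq a ≠ 0 :=
  (map_ne_zero_iff _ emb_injective).2 ha

lemma absK_emb {a : Fq[X]} (ha : a ≠ 0) :
    absK Fq (emb Fq a) = (Fintype.card Fq : ℝ) ^ a.natDegree := by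
  have hc : (emb Fq a).coeff (-(a.natDegree : ℤ)) ≠ 0 := by
    rw [emb_coeff]; simpa using ha
  rw [absK_of_ne (emb_ne_zero ha), ← zpow_natCast]
  congr 1
  have h1 := HahnSeries.order_le_of_coeff_ne_zero hc
  have h2 : -(a.natDegree : ℤ) ≤ (emb Fq a).order := by
    by_contra hlt
    have h3 := mt HahnSeries.coeff_order_eq_zero.1 (emb_ne_zero ha)
    obtain ⟨k, hk⟩ : ∃ k : ℕ, (emb Fq a).order = -(k : ℤ) :=
      ⟨(-(emb Fq a).order).toNat, by omega⟩
    rw [hk, emb_coeff] at h3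
    exact h3 (coeff_eq_zero_of_natDegree_lt (by omega))
  omega

lemma one_le_absK_emb {a : Fq[X]} (ha : a ≠ 0) : 1 ≤ absK Fq (emb Fq a) := by
  rw [absK_emb ha]; exact one_le_pow₀ one_lt_q.le

lemma absK_emb_le (a : Fq[X]) : absK Fq (emb Fq a) ≤ (Fintype.card Fq : ℝ) ^ a.natDegree := by
  by_cases ha : a = 0
  · simp [ha, absK_zero]
  · exact (absK_emb ha).le

/-- Polynomial part. -/
lemma exists_round (x : K Fq) : ∃ a : Fq[X], absK Fq (x - emb Fq a) < 1 := by
  let a : Fq[X] := ∑ k ∈ Finset.range ((-x.order).toNat + 1), monomial k (x.coeff (-(k : ℤ)))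
  refine ⟨a, ?_⟩
  rw [← absK_lt_one_iff, ← zpow_neg_one, absK_le_zpow_iff]
  intro m hm
  obtain ⟨k, rfl⟩ : ∃ k : ℕ, m = -(k : ℤ) := ⟨(-m).toNat, by omega⟩
  rw [HahnSeries.coeff_sub, emb_coeff, sub_eq_zero]
  simp only [a, finsetSum_coeff, coeff_monomial]
  rw [Finset.sum_ite_eq']
  split_ifs with h
  · rfl
  · apply HahnSeries.coeff_eq_zero_of_lt_order
    simp at h; omega

set_option linter.unusedSectionVars false
/-! ### Heights -/

/-- Logarithmic height. -/
def hh (P : Fq[X][X]) : ℕ := P.support.sup fun i => (P.coeff i).natDegree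

lemma HP_eq (P : Fq[X][X]) : HP Fq P = (Fintype.card Fq : ℝ) ^ hh P := rfl

lemma one_le_HP (P : Fq[X][X]) : 1 ≤ HP Fq P := one_le_pow₀ one_lt_q.le

lemma HP_pos (P : Fq[X][X]) : 0 < HP Fq P := lt_of_lt_of_le one_pos (one_le_HP P)

lemma hh_le_iff (P : Fq[X][X]) (N : ℕ) : hh P ≤ N ↔ ∀ i, (P.coeff i).natDegree ≤ N := by
  rw [hh, Finset.sup_le_iff]
  constructor
  · intro h i
    by_cases hi : i ∈ P.support
    · exact h i hi
    · simp [notMem_support_iff.1 hi]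
  · intro h i _
    exact h i

lemma natDegree_coeff_le (P : Fq[X][X]) (i : ℕ) : (P.coeff i).natDegree ≤ hh P :=
  (hh_le_iff P _).1 le_rfl i

lemma absK_coeff_le (P : Fq[X][X]) (i : ℕ) : absK Fq (emb Fq (P.coeff i)) ≤ HP Fq P :=
  (absK_emb_le _).trans (pow_le_pow_right₀ one_lt_q.le (natDegree_coeff_le P i))

lemma HP_le (P : Fq[X][X]) {B : ℝ} (hB : 1 ≤ B)
    (h : ∀ i, absK Fq (emb Fq (P.coeff i)) ≤ B) : HP Fq P ≤ B := by
  rw [HP_eq]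
  by_cases h0 : P.support = ∅
  · simpa [hh, h0] using hB
  · obtain ⟨i, hi, hi2⟩ := Finset.exists_mem_eq_sup P.support
      (Finset.nonempty_iff_ne_empty.2 h0) (fun i => (P.coeff i).natDegree)
    rw [hh, hi2, ← absK_emb (mem_support_iff.1 hi)]
    exact h i

lemma coeff_swap (P : Fq[X][X]) (i j : ℕ) :
    ((Bivariate.swap P).coeff j).coeff i = (P.coeff i).coeff j := by
  induction P using Polynomial.induction_on' with
  | add p q hp hq => simp [hp, hq]
  | monomial n a =>
    induction a using Polynomial.induction_on' with
    | add p q hp hq => simp only [map_add, coeff_add, hp, hq]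
    | monomial m c =>
      rw [Bivariate.swap_monomial_monomial]
      simp only [coeff_monomial]
      by_cases h1 : m = j <;> by_cases h2 : n = i <;> simp [h1, h2, coeff_monomial]

lemma natDegree_swap (P : Fq[X][X]) : (Bivariate.swap P).natDegree = hh P := by
  apply eq_of_forall_ge_iff
  intro N
  rw [hh_le_iff, natDegree_le_iff_coeff_eq_zero]
  constructor
  · intro h i
    rw [natDegree_le_iff_coeff_eq_zero]
    intro j hj
    rw [← coeff_swap, h j hj, coeff_zero]
  · intro h j hj
    ext i
    rw [coeff_swap, coeff_zero]
    exact natDegree_le_iff_coeff_eq_zero.1 (h i) j hj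

lemma HP_mul {P Q : Fq[X][X]} (hP : P ≠ 0) (hQ : Q ≠ 0) :
    HP Fq (P * Q) = HP Fq P * HP Fq Q := by
  rw [HP_eq, HP_eq, HP_eq, ← pow_add, ← natDegree_swap, map_mul,
    natDegree_mul (by simpa using hP) (by simpa using hQ), natDegree_swap, natDegree_swap]

lemma HP_le_of_dvd {P Q : Fq[X][X]} (hQ : Q ≠ 0) (h : P ∣ Q) : HP Fq P ≤ HP Fq Q := by
  obtain ⟨R, rfl⟩ := h
  rw [HP_mul (left_ne_zero_of_mul hQ) (right_ne_zero_of_mul hQ)]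
  exact le_mul_of_one_le_right (HP_pos P).le (one_le_HP R)

lemma finite_HP_le (n : ℕ) (B : ℝ) :
    {P : Fq[X][X] | P.natDegree ≤ n ∧ HP Fq P ≤ B}.Finite := by
  obtain ⟨N, hN⟩ := pow_unbounded_of_one_lt B (one_lt_q (Fq := Fq))
  have hsub : {P : Fq[X][X] | P.natDegree ≤ n ∧ HP Fq P ≤ B} ⊆
      {P : Fq[X][X] | P.natDegree ≤ n ∧ hh P ≤ N} := by
    rintro P ⟨h1, h2⟩
    refine ⟨h1, ?_⟩
    have := h2.trans_lt hN
    rw [HP_eq, pow_lt_pow_iff_right₀ one_lt_q] at this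
    exact this.le
  refine Set.Finite.subset ?_ hsub
  let f : Fq[X][X] → (Fin (n + 1) → Fin (N + 1) → Fq) := fun P i j => (P.coeff i).coeff j
  refine Set.Finite.of_finite_image (f := f) (Set.toFinite _) ?_
  rintro P ⟨hP1, hP2⟩ Q ⟨hQ1, hQ2⟩ hPQ
  ext i j
  by_cases hi : i < n + 1
  · by_cases hj : j < N + 1
    · exact congrFun (congrFun hPQ ⟨i, hi⟩) ⟨j, hj⟩
    · rw [coeff_eq_zero_of_natDegree_lt, coeff_eq_zero_of_natDegree_lt]
      · have := natDegree_coeff_le Q i; omega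
      · have := natDegree_coeff_le P i; omega
  · rw [coeff_eq_zero_of_natDegree_lt (p := P) (by omega),
      coeff_eq_zero_of_natDegree_lt (p := Q) (by omega)]

/-! ### Evaluation -/

lemma evalK_eq (P : Fq[X][X]) (ξ : K Fq) : evalK Fq P ξ = (P.map (emb Fq)).eval ξ :=
  eval₂_eq_eval_map _

lemma evalK_mul (P Q : Fq[X][X]) (ξ : K Fq) :
    evalK Fq (P * Q) ξ = evalK Fq P ξ * evalK Fq Q ξ := eval₂_mul _ _

/-- `max 1 |ξ|`. -/
def mx (ξ : K Fq) : ℝ := max 1 (absK Fq ξ)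

lemma one_le_mx (ξ : K Fq) : 1 ≤ mx ξ := le_max_left _ _
lemma mx_pos (ξ : K Fq) : 0 < mx ξ := lt_of_lt_of_le one_pos (one_le_mx ξ)
lemma absK_le_mx (ξ : K Fq) : absK Fq ξ ≤ mx ξ := le_max_right _ _

lemma absK_pow_le_mx (ξ : K Fq) {i n : ℕ} (h : i ≤ n) : absK Fq (ξ ^ i) ≤ mx ξ ^ n := by
  rw [absK_pow]
  calc _ ≤ mx ξ ^ i := pow_le_pow_left₀ (absK_nonneg _) (absK_le_mx ξ) i
    _ ≤ _ := pow_le_pow_right₀ (one_le_mx ξ) h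

lemma absK_eval_le (F : (K Fq)[X]) (x : K Fq) {n : ℕ} (hn : F.natDegree ≤ n) {B : ℝ}
    (hF : ∀ i, absK Fq (F.coeff i) ≤ B) : absK Fq (F.eval x) ≤ B * mx x ^ n := by
  have hB : 0 ≤ B := (absK_nonneg _).trans (hF 0)
  rw [eval_eq_sum_range]
  apply absK_sum_le _ _ (mul_nonneg hB (pow_nonneg (mx_pos x).le n))
  intro i hi
  rw [absK_mul]
  have : i ≤ n := by simp at hi; omega
  exact mul_le_mul (hF i) (absK_pow_le_mx x this) (absK_nonneg _) hB

lemma absK_evalK_le (P : Fq[X][X]) (x : K Fq) {n : ℕ} (hn : P.natDegree ≤ n) :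
    absK Fq (evalK Fq P x) ≤ HP Fq P * mx x ^ n := by
  rw [evalK_eq]
  apply absK_eval_le
  · exact natDegree_map_le.trans hn
  · intro i; rw [coeff_map]; exact absK_coeff_le P i

lemma evalK_C (c : Fq[X]) (x : K Fq) : evalK Fq (C c) x = emb Fq c := eval₂_C _ _

lemma natDegree_map_emb (P : Fq[X][X]) : (P.map (emb Fq)).natDegree = P.natDegree :=
  natDegree_map_eq_of_injective emb_injective P

/-! ### Irreducible polynomials -/

/-- The embedding of the fraction field. -/
def embFrac (Fq : Type) [Field Fq] [Fintype Fq] : FractionRing Fq[X] →+* K Fq :=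
  IsFractionRing.lift (A := Fq[X]) (emb_injective (Fq := Fq))

lemma embFrac_comp : (embFrac Fq).comp (algebraMap Fq[X] (FractionRing Fq[X])) = emb Fq := by
  refine RingHom.ext fun x => ?_
  simp [embFrac]

lemma coprime_of_not_dvd {P Q : Fq[X][X]} (hP : Irreducible P) (hP0 : 0 < P.natDegree)
    (h : ¬ P ∣ Q) : IsCoprime (P.map (emb Fq)) (Q.map (emb Fq)) := by
  have hprim : P.IsPrimitive := hP.isPrimitive hP0.ne'
  by_cases hQ0 : Q = 0
  · exact absurd (hQ0 ▸ dvd_zero P) h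
  have h1 : Irreducible (P.map (algebraMap Fq[X] (FractionRing Fq[X]))) :=
    (hprim.irreducible_iff_irreducible_map_fraction_map).1 hP
  have h2 : IsCoprime (P.map (algebraMap Fq[X] (FractionRing Fq[X])))
      (Q.map (algebraMap Fq[X] (FractionRing Fq[X]))) := by
    rw [h1.coprime_iff_not_dvd]
    intro hd
    exact h ((IsPrimitive.dvd_iff_fraction_map_dvd_fraction_map (FractionRing Fq[X]) hprim).2 hd)
  have h3 := h2.map (mapRingHom (embFrac Fq))
  simpa only [coe_mapRingHom, Polynomial.map_map, embFrac_comp] using h3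

lemma natDegree_pos_of_root {P : Fq[X][X]} {α : K Fq} (hP : P ≠ 0) (h : evalK Fq P α = 0) :
    0 < P.natDegree := by
  rw [Nat.pos_iff_ne_zero]
  intro h0
  rw [eq_C_of_natDegree_eq_zero h0, evalK_C] at h
  apply hP
  rw [eq_C_of_natDegree_eq_zero h0, emb_injective (h.trans (map_zero _).symm), C_0]

lemma dvd_of_root {P Q : Fq[X][X]} {α : K Fq} (hP : Irreducible P)
    (h : evalK Fq P α = 0) (hQ : evalK Fq Q α = 0) : P ∣ Q := by
  by_contra hd
  obtain ⟨a, b, hab⟩ := coprime_of_not_dvd hP (natDegree_pos_of_root hP.ne_zero h) hd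
  have := congrArg (eval α) hab
  rw [evalK_eq] at h hQ
  simp [h, hQ] at this

lemma exists_irreducible_root {P : Fq[X][X]} {α : K Fq} (hP : P ≠ 0)
    (h : evalK Fq P α = 0) : ∃ Q : Fq[X][X], Irreducible Q ∧ Q ∣ P ∧ evalK Fq Q α = 0 := by
  induction P using WfDvdMonoid.induction_on_irreducible with
  | zero => exact absurd rfl hP
  | unit u hu =>
    exfalso
    have h0 := natDegree_pos_of_root hP h
    rw [natDegree_eq_zero_of_isUnit hu] at h0
    omega
  | mul a i ha hi ih =>
    rw [evalK_mul, mul_eq_zero] at h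
    rcases h with h | h
    · exact ⟨i, hi, dvd_mul_right _ _, h⟩
    · obtain ⟨Q, h1, h2, h3⟩ := ih ha h
      exact ⟨Q, h1, h2.mul_left _, h3⟩

/-! ### Degree and height of algebraic elements -/

lemma degA_le {P : Fq[X][X]} {α : K Fq} (hP : P ≠ 0) (h : evalK Fq P α = 0) :
    degA Fq α ≤ P.natDegree := Nat.sInf_le ⟨P, hP, rfl, h⟩

lemma degA_eq {P : Fq[X][X]} {α : K Fq} (hP : Irreducible P) (h : evalK Fq P α = 0) :
    degA Fq α = P.natDegree := by
  apply le_antisymm (degA_le hP.ne_zero h)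
  unfold degA
  refine le_csInf ⟨P.natDegree, P, hP.ne_zero, rfl, h⟩ ?_
  rintro d ⟨Q, hQ, rfl, hQ0⟩
  exact natDegree_le_of_dvd (dvd_of_root hP h hQ0) hQ

lemma HA_le {P : Fq[X][X]} {α : K Fq} (hP : P ≠ 0) (h : evalK Fq P α = 0) :
    HA Fq α ≤ HP Fq P := by
  obtain ⟨Q, hQ, hQP, hQ0⟩ := exists_irreducible_root hP h
  refine le_trans ?_ (HP_le_of_dvd hP hQP)
  apply csInf_le
  · refine ⟨1, ?_⟩
    rintro _ ⟨R, -, -, -, rfl⟩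
    exact one_le_HP R
  · exact ⟨Q, hQ.ne_zero, (degA_eq hQ hQ0).symm, hQ0, rfl⟩

lemma exists_HA {α : K Fq} (hα : IsAlgK Fq α) : ∃ P : Fq[X][X], P ≠ 0 ∧
    P.natDegree = degA Fq α ∧ evalK Fq P α = 0 ∧ HP Fq P = HA Fq α := by
  obtain ⟨P, hP, h⟩ := hα
  obtain ⟨Q, hQ, hQP, hQ0⟩ := exists_irreducible_root hP h
  have hne : ∃ k : ℕ, ∃ R : Fq[X][X], R ≠ 0 ∧ R.natDegree = degA Fq α ∧ evalK Fq R α = 0 ∧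
      hh R = k := ⟨_, Q, hQ.ne_zero, (degA_eq hQ hQ0).symm, hQ0, rfl⟩
  obtain ⟨R, h1, h2, h3, h4⟩ := Nat.find_spec hne
  refine ⟨R, h1, h2, h3, le_antisymm ?_ (HA_le h1 h3)⟩
  unfold HA
  refine le_csInf ⟨HP Fq R, R, h1, h2, h3, rfl⟩ ?_
  rintro _ ⟨S, g1, g2, g3, rfl⟩
  rw [HP_eq, HP_eq, h4]
  exact pow_le_pow_right₀ one_lt_q.le (Nat.find_min' hne ⟨S, g1, g2, g3, rfl⟩)

lemma one_le_HA {α : K Fq} (hα : IsAlgK Fq α) : 1 ≤ HA Fq α := by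
  obtain ⟨P, -, -, -, h⟩ := exists_HA hα
  exact h ▸ one_le_HP P

lemma finite_roots {P : Fq[X][X]} (hP : P ≠ 0) : {α : K Fq | evalK Fq P α = 0}.Finite := by
  have h0 : P.map (emb Fq) ≠ 0 := (Polynomial.map_ne_zero_iff emb_injective).2 hP
  refine ((P.map (emb Fq)).roots.toFinset.finite_toSet).subset ?_
  intro α hα
  simp only [Set.mem_setOf_eq, evalK_eq] at hα
  simpa [h0] using hα

lemma finite_HA_le (n : ℕ) (B : ℝ) :
    {α : K Fq | IsAlgK Fq α ∧ degA Fq α ≤ n ∧ HA Fq α ≤ B}.Finite := by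
  refine Set.Finite.subset (Set.Finite.biUnion
    ((finite_HP_le (Fq := Fq) n B).subset (Set.sep_subset _ (fun P => P ≠ 0)))
    (t := fun P => {α : K Fq | evalK Fq P α = 0}) (fun P hP => finite_roots hP.2)) ?_
  rintro α ⟨h1, h2, h3⟩
  obtain ⟨P, hP, hd, h0, hH⟩ := exists_HA h1
  simp only [Set.mem_iUnion]
  exact ⟨P, ⟨⟨hd ▸ h2, hH ▸ h3⟩, hP⟩, h0⟩

set_option linter.unusedSectionVars false
/-! ### Resultants -/

lemma absK_det_le {N : ℕ} (M : Matrix (Fin N) (Fin N) (K Fq)) (i0 : Fin N) (B : Fin N → ℝ)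
    {ε : ℝ} (hB : ∀ j, 0 ≤ B j) (hε : 0 ≤ ε) (h : ∀ i j, i ≠ i0 → absK Fq (M i j) ≤ B j)
    (h0 : ∀ j, absK Fq (M i0 j) ≤ ε * B j) : absK Fq M.det ≤ ε * ∏ j, B j := by
  rw [Matrix.det_apply]
  apply absK_sum_le _ _ (mul_nonneg hε (Finset.prod_nonneg fun j _ => hB j))
  intro σ _
  have h1 : absK Fq (Equiv.Perm.sign σ • ∏ i, M (σ i) i) = absK Fq (∏ i, M (σ i) i) := by
    rcases Int.units_eq_one_or (Equiv.Perm.sign σ) with h | h <;> rw [h] <;> simp [absK_neg]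
  rw [h1, absK_prod, ← Finset.mul_prod_erase _ _ (Finset.mem_univ (σ.symm i0)),
    ← Finset.mul_prod_erase _ B (Finset.mem_univ (σ.symm i0)), ← mul_assoc]
  apply mul_le_mul
  · simpa using h0 (σ.symm i0)
  · apply Finset.prod_le_prod
    · intro i _; exact absK_nonneg _
    · intro i hi
      apply h
      intro hc
      simp only [Finset.mem_erase, Finset.mem_univ, and_true] at hi
      apply hi
      rw [← hc]; simp
  · exact Finset.prod_nonneg fun i _ => absK_nonneg _
  · exact mul_nonneg hε (hB _)

lemma sylv_entry (g : (K Fq)[X]) {n : ℕ} (hg : g.natDegree ≤ n) (i j : ℕ) :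
    (if i ∈ Set.Icc j (j + n) then g.coeff (i - j) else 0) = (X ^ j * g).coeff i := by
  rw [coeff_X_pow_mul']
  by_cases h1 : j ≤ i
  · by_cases h2 : i ≤ j + n
    · simp [h1, h2]
    · rw [if_neg (by simp [h2]), if_pos h1, coeff_eq_zero_of_natDegree_lt (by omega)]
  · simp [h1]

lemma sylv_sum (g : (K Fq)[X]) {N j : ℕ} (hg : j + g.natDegree < N) (ξ : K Fq) :
    ∑ i : Fin N, ξ ^ (i : ℕ) * (X ^ j * g).coeff i = ξ ^ j * g.eval ξ := by
  have h : (X ^ j * g).natDegree < N := lt_of_le_of_lt natDegree_mul_le (by simpa using hg)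
  rw [Fin.sum_univ_eq_sum_range (fun i : ℕ => ξ ^ i * ((X ^ j * g : (K Fq)[X]).coeff i : K Fq))]
  have := eval_eq_sum_range' h ξ
  rw [eval_mul, eval_pow, eval_X] at this
  rw [this]
  exact Finset.sum_congr rfl fun i _ => mul_comm _ _

lemma resultant_bound {P Q : Fq[X][X]} (hPQ : IsCoprime (P.map (emb Fq)) (Q.map (emb Fq)))
    (hP : 0 < P.natDegree) (ξ : K Fq) {rP rQ ε : ℝ} (hrP : HP Fq P ≤ rP) (hrQ : HP Fq Q ≤ rQ)
    (hε1 : absK Fq (evalK Fq P ξ) ≤ ε * rP) (hε2 : absK Fq (evalK Fq Q ξ) ≤ ε * rQ) :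
    1 ≤ ε * mx ξ ^ (P.natDegree + Q.natDegree) * (rQ ^ P.natDegree * rP ^ Q.natDegree) := by
  have hrP0 : 0 < rP := (HP_pos P).trans_le hrP
  have hrQ0 : 0 < rQ := (HP_pos Q).trans_le hrQ
  have hε : 0 ≤ ε := by
    by_contra hc
    push Not at hc
    have := (absK_nonneg _).trans hε1
    nlinarith
  set f := P.map (emb Fq) with hf
  set g := Q.map (emb Fq) with hg
  set m := P.natDegree with hm
  set n := Q.natDegree with hn
  have hfm : f.natDegree = m := natDegree_map_emb P
  have hgn : g.natDegree = n := natDegree_map_emb Q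
  have hres : resultant P Q m n ≠ 0 := by
    intro h0
    have h1 : resultant f g m n = 0 := by rw [hf, hg, resultant_map_map, h0, map_zero]
    rw [← hfm, ← hgn, resultant_eq_zero_iff] at h1
    exact h1.2 hPQ
  have h1 : 1 ≤ absK Fq (resultant f g m n) := by
    rw [hf, hg, resultant_map_map]; exact one_le_absK_emb hres
  let i0 : Fin (m + n) := ⟨0, by omega⟩
  set S := sylvester f g m n with hS
  have hSl : ∀ i (j : Fin m), S i (Fin.castAdd n j) = (X ^ (j : ℕ) * g).coeff i := by
    intro i j
    rw [← sylv_entry g hgn.le]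
    simp [hS, sylvester]
  have hSr : ∀ i (j : Fin n), S i (Fin.natAdd m j) = (X ^ (j : ℕ) * f).coeff i := by
    intro i j
    rw [← sylv_entry f hfm.le]
    simp [hS, sylvester]
  have hdet : (S.updateRow i0 (∑ k : Fin (m + n), (ξ ^ (k : ℕ)) • S k)).det = resultant f g m n := by
    rw [Matrix.det_updateRow_sum]
    simp [i0, resultant, hS]
  rw [← hdet] at h1
  refine h1.trans ?_
  have hprod : rQ ^ m * rP ^ n =
      ∏ j : Fin (m + n), Fin.addCases (motive := fun _ => ℝ) (fun _ => rQ) (fun _ => rP) j := by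
    rw [Fin.prod_univ_add]; simp
  have hcoef : ∀ (R : Fq[X][X]) (r : ℝ) (hr : HP Fq R ≤ r) (i j : ℕ),
      absK Fq ((X ^ j * R.map (emb Fq)).coeff i) ≤ r := by
    intro R r hr i j
    rw [coeff_X_pow_mul']
    split_ifs
    · rw [coeff_map]; exact (absK_coeff_le R _).trans hr
    · rw [absK_zero]; exact (HP_pos R).le.trans hr
  rw [hprod]
  have hpm : ∀ j, j ≤ m + n → absK Fq (ξ ^ j) ≤ mx ξ ^ (m + n) := fun j hj => absK_pow_le_mx ξ hj
  apply absK_det_le _ i0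
  · intro j
    induction j using Fin.addCases <;> simp [hrP0.le, hrQ0.le]
  · exact mul_nonneg hε (pow_nonneg (mx_pos ξ).le _)
  · intro i j hi
    rw [Matrix.updateRow_ne hi]
    induction j using Fin.addCases with
    | left j => rw [hSl]; simpa using hcoef Q rQ hrQ i j
    | right j => rw [hSr]; simpa using hcoef P rP hrP i j
  · intro j
    rw [Matrix.updateRow_self]
    induction j using Fin.addCases with
    | left j =>
      simp only [Finset.sum_apply, Pi.smul_apply, smul_eq_mul, hSl, Fin.addCases_left]
      rw [sylv_sum g (by omega), absK_mul]
      calc _ ≤ mx ξ ^ (m + n) * (ε * rQ) := by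
            apply mul_le_mul (hpm _ (by omega)) _ (absK_nonneg _) (pow_nonneg (mx_pos ξ).le _)
            rw [hg, ← evalK_eq]; exact hε2
        _ = _ := by ring
    | right j =>
      simp only [Finset.sum_apply, Pi.smul_apply, smul_eq_mul, hSr, Fin.addCases_right]
      rw [sylv_sum f (by omega), absK_mul]
      calc _ ≤ mx ξ ^ (m + n) * (ε * rP) := by
            apply mul_le_mul (hpm _ (by omega)) _ (absK_nonneg _) (pow_nonneg (mx_pos ξ).le _)
            rw [hf, ← evalK_eq]; exact hε1
        _ = _ := by ring

set_option linter.unusedSectionVars false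
/-! ### Completeness and Hensel's lemma -/

lemma absK_natCast_le (n : ℕ) : absK Fq (n : K Fq) ≤ 1 := by
  induction n with
  | zero => simp [absK_zero]
  | succ n ih => push_cast; exact absK_add_le_of ih absK_one.le

lemma exists_limit (y : ℕ → K Fq) (h0 : ∀ k, absK Fq (y k) ≤ 1)
    (h : ∀ k, absK Fq (y (k + 1) - y k) ≤ (Fintype.card Fq : ℝ) ^ (-(k : ℤ))) :
    ∃ L : K Fq, absK Fq L ≤ 1 ∧ ∀ k, absK Fq (y k - L) ≤ (Fintype.card Fq : ℝ) ^ (-(k : ℤ)) := by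
  have hneg : ∀ k (m : ℤ), m < 0 → (y k).coeff m = 0 := by
    intro k m hm
    have := (absK_le_zpow_iff (y k) 0).1 (by simpa using h0 k)
    exact this m hm
  have hd : ∀ k j, absK Fq (y (k + j) - y k) ≤ (Fintype.card Fq : ℝ) ^ (-(k : ℤ)) := by
    intro k j
    induction j with
    | zero => simp [absK_zero]
    | succ j ih =>
      have h1 : y (k + (j + 1)) - y k = (y (k + j + 1) - y (k + j)) + (y (k + j) - y k) := by
        rw [← add_assoc]; ring
      rw [h1]
      refine absK_add_le_of ((h (k + j)).trans ?_) ih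
      exact zpow_le_zpow_right₀ one_lt_q.le (by push_cast; omega)
  let f : ℤ → Fq := fun m => if m < 0 then 0 else (y (m.toNat + 1)).coeff m
  have hf : BddBelow (Function.support f) := by
    refine ⟨0, ?_⟩
    intro m hm
    by_contra hc
    push Not at hc
    exact hm (by simp [f, hc])
  refine ⟨HahnSeries.ofSuppBddBelow f hf, ?_, ?_⟩
  · have := (absK_le_zpow_iff (HahnSeries.ofSuppBddBelow f hf) 0).2
    simp only [neg_zero, zpow_zero] at this
    apply this
    intro m hm
    simp [f, hm]
  · intro k
    rw [absK_le_zpow_iff]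
    intro m hm
    by_cases hm0 : m < 0
    · simp [f, hm0, hneg k m hm0]
    · lift m to ℕ using by omega
      have hk : k = (m + 1) + (k - (m + 1)) := by omega
      have h2 := (absK_le_zpow_iff _ _).1 (hd (m + 1) (k - (m + 1))) m (by push_cast; omega)
      rw [← hk] at h2
      have hm0' : ¬ ((m : ℤ) < 0) := by omega
      have h3 : f m = (y (m + 1)).coeff m := by simp only [f, if_neg hm0', Int.toNat_natCast]
      rw [HahnSeries.coeff_sub, HahnSeries.coeff_ofSuppBddBelow, h3]
      simpa using h2

lemma exists_fixed (Φ : K Fq → K Fq) (h1 : ∀ y, absK Fq y ≤ 1 → absK Fq (Φ y) ≤ 1)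
    (h2 : ∀ y z, absK Fq y ≤ 1 → absK Fq z ≤ 1 →
      absK Fq (Φ y - Φ z) ≤ (Fintype.card Fq : ℝ)⁻¹ * absK Fq (y - z)) :
    ∃ L, absK Fq L ≤ 1 ∧ Φ L = L := by
  let y : ℕ → K Fq := fun k => Φ^[k] 0
  have hs : ∀ k, y (k + 1) = Φ (y k) := fun k => Function.iterate_succ_apply' Φ k 0
  have hy : ∀ k, absK Fq (y k) ≤ 1 := by
    intro k
    induction k with
    | zero => simp [y, absK_zero]
    | succ k ih => rw [hs]; exact h1 _ ih
  have hd : ∀ k, absK Fq (y (k + 1) - y k) ≤ (Fintype.card Fq : ℝ) ^ (-(k : ℤ)) := by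
    intro k
    induction k with
    | zero => simpa using absK_sub_le_of (hy 1) (hy 0)
    | succ k ih =>
      rw [hs (k + 1)]
      nth_rewrite 2 [hs k]
      refine (h2 _ _ (hy _) (hy _)).trans ?_
      have : (-((k + 1 : ℕ) : ℤ)) = -1 + (-(k : ℤ)) := by push_cast; ring
      rw [this, zpow_add₀ q_pos.ne', zpow_neg_one]
      exact mul_le_mul_of_nonneg_left ih (inv_nonneg.2 q_pos.le)
  obtain ⟨L, hL1, hL⟩ := exists_limit y hy hd
  refine ⟨L, hL1, ?_⟩
  by_contra hne
  have hpos : 0 < absK Fq (Φ L - L) := absK_pos (sub_ne_zero.2 hne)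
  have hb : ∀ k : ℕ, absK Fq (Φ L - L) ≤ ((Fintype.card Fq : ℝ)⁻¹) ^ k := by
    intro k
    rw [inv_pow, ← zpow_natCast, ← zpow_neg]
    have h3 : Φ L - L = (Φ L - Φ (y k)) + ((y (k + 1) - y k) + (y k - L)) := by rw [hs]; ring
    rw [h3]
    refine absK_add_le_of ?_ (absK_add_le_of (hd k) (hL k))
    refine (h2 _ _ hL1 (hy k)).trans ?_
    rw [absK_sub_comm]
    refine le_trans ?_ (hL k)
    exact mul_le_of_le_one_left (absK_nonneg _) (inv_le_one_of_one_le₀ one_lt_q.le)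
  obtain ⟨k, hk⟩ := exists_pow_lt_of_lt_one hpos (inv_lt_one_of_one_lt₀ (one_lt_q (Fq := Fq)))
  exact absurd (hb k) (not_le.2 hk)

lemma absK_pow_sub_le {x y : K Fq} {M : ℝ} (hM : 1 ≤ M) (hx : absK Fq x ≤ M)
    (hy : absK Fq y ≤ M) (i : ℕ) : absK Fq (x ^ i - y ^ i) ≤ M ^ i * absK Fq (x - y) := by
  induction i with
  | zero => simp [absK_zero, absK_nonneg]
  | succ i ih =>
    have h : x ^ (i + 1) - y ^ (i + 1) = x * (x ^ i - y ^ i) + (x - y) * y ^ i := by ring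
    have hM0 : 0 ≤ M := by linarith
    rw [h]
    apply absK_add_le_of
    · rw [absK_mul, pow_succ']
      rw [mul_assoc]
      exact mul_le_mul hx ih (absK_nonneg _) hM0
    · rw [absK_mul, mul_comm, absK_pow]
      apply mul_le_mul_of_nonneg_right _ (absK_nonneg _)
      calc absK Fq y ^ i ≤ M ^ i := pow_le_pow_left₀ (absK_nonneg _) hy i
        _ ≤ M ^ (i + 1) := pow_le_pow_right₀ hM (by omega)

lemma absK_eval_sub_le (F : (K Fq)[X]) {x y : K Fq} {n : ℕ} (hn : F.natDegree ≤ n) {B M : ℝ}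
    (hF : ∀ i, absK Fq (F.coeff i) ≤ B) (hM : 1 ≤ M) (hx : absK Fq x ≤ M)
    (hy : absK Fq y ≤ M) :
    absK Fq (F.eval x - F.eval y) ≤ B * M ^ n * absK Fq (x - y) := by
  have hB : 0 ≤ B := (absK_nonneg _).trans (hF 0)
  have hM0 : 0 ≤ M := by linarith
  rw [eval_eq_sum_range, eval_eq_sum_range, ← Finset.sum_sub_distrib]
  apply absK_sum_le _ _ (mul_nonneg (mul_nonneg hB (pow_nonneg hM0 n)) (absK_nonneg _))
  intro i hi
  have hi : i ≤ n := by simp at hi; omega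
  rw [← mul_sub, absK_mul, mul_assoc]
  apply mul_le_mul (hF i) _ (absK_nonneg _) hB
  refine (absK_pow_sub_le hM hx hy i).trans ?_
  exact mul_le_mul_of_nonneg_right (pow_le_pow_right₀ hM hi) (absK_nonneg _)

lemma absK_taylor_le (F : (K Fq)[X]) (x : K Fq) {n : ℕ} (hn : F.natDegree ≤ n) {B : ℝ}
    (hF : ∀ i, absK Fq (F.coeff i) ≤ B) (j : ℕ) :
    absK Fq ((taylor x F).coeff j) ≤ B * mx x ^ n := by
  rw [taylor_coeff]
  apply absK_eval_le
  · exact (natDegree_hasseDeriv_le F j).trans (by omega)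
  · intro i
    rw [hasseDeriv_coeff, absK_mul]
    refine (mul_le_of_le_one_left (absK_nonneg _) (absK_natCast_le _)).trans (hF _)

lemma hensel (F : (K Fq)[X]) (ξ : K Fq) {n : ℕ} (hn : F.natDegree ≤ n) {B : ℝ}
    (hF : ∀ i, absK Fq (F.coeff i) ≤ B)
    (h : absK Fq (F.eval ξ) * (B * mx ξ ^ n) < absK Fq (F.derivative.eval ξ) ^ 2) :
    ∃ α : K Fq, F.eval α = 0 ∧
      absK Fq (ξ - α) ≤ absK Fq (F.eval ξ) / absK Fq (F.derivative.eval ξ) := by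
  by_cases h0 : F.eval ξ = 0
  · exact ⟨ξ, h0, by simp [h0, absK_zero]⟩
  set G := taylor ξ F with hG
  set F0 := F.eval ξ with hF0
  set F1 := F.derivative.eval ξ with hF1
  have hG0 : G.coeff 0 = F0 := taylor_coeff_zero _ _
  have hG1 : G.coeff 1 = F1 := taylor_coeff_one _ _
  have hGb : ∀ j, absK Fq (G.coeff j) ≤ B * mx ξ ^ n := absK_taylor_le F ξ hn hF
  have hB : 0 ≤ B := (absK_nonneg _).trans (hF 0)
  have hB' : 0 ≤ B * mx ξ ^ n := mul_nonneg hB (pow_nonneg (mx_pos ξ).le n)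
  have hF0p : 0 < absK Fq F0 := absK_pos h0
  have hF1' : F1 ≠ 0 := by
    intro hc
    rw [hc, absK_zero] at h
    have := mul_nonneg hF0p.le hB'
    simp at h; linarith
  have hF1p : 0 < absK Fq F1 := absK_pos hF1'
  have hle : absK Fq F1 ≤ B * mx ξ ^ n := hG1 ▸ hGb 1
  have hlt : absK Fq F0 < absK Fq F1 := by
    by_contra hc
    push Not at hc
    have : absK Fq F1 * absK Fq F1 ≤ absK Fq F0 * (B * mx ξ ^ n) :=
      mul_le_mul hc hle hF1p.le hF0p.le
    nlinarith
  set t := F0 / F1 with ht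
  have ht1 : absK Fq t ≤ 1 := by
    rw [ht, absK_div, div_le_one hF1p]; exact hlt.le
  let c : ℕ → K Fq := fun i => G.coeff (i + 2) * t ^ (i + 2) / F0
  have hc : ∀ i, absK Fq (c i) ≤ (Fintype.card Fq : ℝ)⁻¹ := by
    intro i
    rw [absK_lt_one_iff]
    simp only [c]
    rw [absK_div, absK_mul, absK_pow, div_lt_one hF0p]
    have h3 : absK Fq t ^ (i + 2) ≤ absK Fq t ^ 2 :=
      pow_le_pow_of_le_one (absK_nonneg _) ht1 (by omega)
    have h4 : absK Fq t ^ 2 * absK Fq F1 ^ 2 = absK Fq F0 ^ 2 := by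
      rw [ht, absK_div]; field_simp
    calc _ ≤ (B * mx ξ ^ n) * absK Fq t ^ 2 :=
          mul_le_mul (hGb _) h3 (pow_nonneg (absK_nonneg _) _) hB'
      _ < absK Fq F0 := by
          have h5 : 0 < absK Fq F1 ^ 2 := by positivity
          rw [← mul_lt_mul_iff_left₀ h5, mul_assoc, h4]
          nlinarith
  let Φ : K Fq → K Fq := fun y => -1 - ∑ i ∈ Finset.range n, c i * y ^ (i + 2)
  have hqi : (0 : ℝ) ≤ (Fintype.card Fq : ℝ)⁻¹ := inv_nonneg.2 q_pos.le
  obtain ⟨L, hL1, hL⟩ := exists_fixed Φ (by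
      intro y hy
      apply absK_sub_le_of
      · rw [absK_neg, absK_one]
      · apply absK_sum_le _ _ zero_le_one
        intro i _
        rw [absK_mul, absK_pow]
        exact mul_le_one₀ ((hc i).trans (inv_le_one_of_one_le₀ one_lt_q.le))
          (pow_nonneg (absK_nonneg _) _) (pow_le_one₀ (absK_nonneg _) hy)) (by
      intro y z hy hz
      have h5 : Φ y - Φ z = ∑ i ∈ Finset.range n, c i * (z ^ (i + 2) - y ^ (i + 2)) := by
        simp only [Φ, mul_sub, Finset.sum_sub_distrib]; ring
      rw [h5]
      apply absK_sum_le _ _ (mul_nonneg hqi (absK_nonneg _))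
      intro i _
      rw [absK_mul]
      apply mul_le_mul (hc i) _ (absK_nonneg _) hqi
      have := absK_pow_sub_le le_rfl hz hy (i + 2)
      rw [absK_sub_comm y z]
      simpa using this)
  refine ⟨ξ + t * L, ?_, ?_⟩
  · have h6 : F.eval (ξ + t * L) = G.eval (t * L) := by
      rw [hG, taylor_eval, add_comm]
    have hGn : G.natDegree < n + 2 := by rw [hG, natDegree_taylor]; omega
    rw [h6, eval_eq_sum_range' hGn, Finset.sum_range_succ', Finset.sum_range_succ']
    have h7 : L + 1 + ∑ i ∈ Finset.range n, c i * L ^ (i + 2) = 0 := by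
      have : -1 - ∑ i ∈ Finset.range n, c i * L ^ (i + 2) = L := hL
      linear_combination -this
    have h8 : ∑ i ∈ Finset.range n, G.coeff (i + 1 + 1) * (t * L) ^ (i + 1 + 1) =
        F0 * ∑ i ∈ Finset.range n, c i * L ^ (i + 2) := by
      rw [Finset.mul_sum]
      apply Finset.sum_congr rfl
      intro i _
      simp only [c]
      rw [mul_pow]
      field_simp
    rw [h8]
    simp only [zero_add, hG1, hG0, pow_one, pow_zero, mul_one]
    have h9 : F1 * (t * L) = F0 * L := by rw [ht]; field_simp
    rw [h9]
    linear_combination F0 * h7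
  · have h6 : ξ - (ξ + t * L) = -(t * L) := by ring
    rw [h6, absK_neg, absK_mul, ← absK_div]
    exact mul_le_of_le_one_right (absK_nonneg _) hL1

set_option linter.unusedSectionVars false
/-! ### Factorisation and inseparable descent -/

lemma one_le_absK_eval_of_natDegree_zero {P : Fq[X][X]} {ξ : K Fq} (hP : P.natDegree = 0)
    (h : 0 < absK Fq (evalK Fq P ξ)) : 1 ≤ absK Fq (evalK Fq P ξ) := by
  rw [eq_C_of_natDegree_eq_zero hP, evalK_C] at h ⊢
  apply one_le_absK_emb
  intro h0
  rw [h0, map_zero, absK_zero] at h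
  exact lt_irrefl _ h

lemma HP_rpow_le_one (P : Fq[X][X]) {w : ℝ} (hw : 0 ≤ w) : HP Fq P ^ (-w) ≤ 1 :=
  Real.rpow_le_one_of_one_le_of_nonpos (one_le_HP P) (by linarith)

lemma evalK_zero (ξ : K Fq) : evalK Fq 0 ξ = 0 := eval₂_zero _ _

lemma ne_zero_of_eval_pos {P : Fq[X][X]} {ξ : K Fq} (h : 0 < absK Fq (evalK Fq P ξ)) : P ≠ 0 := by
  rintro rfl
  rw [evalK_zero, absK_zero] at h
  exact lt_irrefl _ h

lemma exists_factor {ξ : K Fq} {w δ : ℝ} (hw : 0 ≤ w) (hδ : 0 < δ) {P : Fq[X][X]}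
    (h0 : 0 < absK Fq (evalK Fq P ξ))
    (h : absK Fq (evalK Fq P ξ) < δ ^ P.natDegree * HP Fq P ^ (-w)) :
    ∃ Q : Fq[X][X], Irreducible Q ∧ 0 < Q.natDegree ∧ Q.natDegree ≤ P.natDegree ∧
      0 < absK Fq (evalK Fq Q ξ) ∧
      absK Fq (evalK Fq Q ξ) < δ ^ Q.natDegree * HP Fq Q ^ (-w) := by
  have key : ∀ P : Fq[X][X], P.natDegree = 0 → 0 < absK Fq (evalK Fq P ξ) →
      absK Fq (evalK Fq P ξ) < δ ^ P.natDegree * HP Fq P ^ (-w) → False := by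
    intro P hP h0 h
    have h1 := one_le_absK_eval_of_natDegree_zero hP h0
    rw [hP, pow_zero, one_mul] at h
    linarith [HP_rpow_le_one P hw]
  induction P using WfDvdMonoid.induction_on_irreducible with
  | zero => simp [evalK_zero, absK_zero] at h0
  | unit u hu => exact (key u (natDegree_eq_zero_of_isUnit hu) h0 h).elim
  | mul a i ha hi ih =>
    have hia : i * a ≠ 0 := mul_ne_zero hi.ne_zero ha
    rw [evalK_mul, absK_mul] at h0 h
    have hi0 : 0 < absK Fq (evalK Fq i ξ) := by
      rcases (absK_nonneg (evalK Fq i ξ)).eq_or_lt with h | h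
      · rw [← h, zero_mul] at h0; exact absurd h0 (lt_irrefl _)
      · exact h
    have ha0 : 0 < absK Fq (evalK Fq a ξ) := pos_of_mul_pos_right h0 hi0.le
    have hdeg : (i * a).natDegree = i.natDegree + a.natDegree := natDegree_mul hi.ne_zero ha
    by_cases hc : absK Fq (evalK Fq i ξ) < δ ^ i.natDegree * HP Fq i ^ (-w)
    · refine ⟨i, hi, ?_, by omega, hi0, hc⟩
      by_contra hd
      exact key i (by omega) hi0 hc
    · push Not at hc
      have h2 : absK Fq (evalK Fq a ξ) < δ ^ a.natDegree * HP Fq a ^ (-w) := by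
        by_contra hc2
        push Not at hc2
        rw [hdeg, HP_mul hi.ne_zero ha, Real.mul_rpow (HP_pos i).le (HP_pos a).le, pow_add] at h
        have h3 := mul_le_mul hc hc2 (mul_nonneg (pow_nonneg hδ.le _)
          (Real.rpow_nonneg (HP_pos a).le _)) hi0.le
        have h4 : δ ^ i.natDegree * HP Fq i ^ (-w) * (δ ^ a.natDegree * HP Fq a ^ (-w)) =
          δ ^ i.natDegree * δ ^ a.natDegree * (HP Fq i ^ (-w) * HP Fq a ^ (-w)) := by ring
        linarith
      obtain ⟨Q, q1, q2, q3, q4⟩ := ih ha0 h2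
      exact ⟨Q, q1, q2, by omega, q4⟩

lemma pdecomp (p : ℕ) [Fact p.Prime] [CharP Fq p] (a : Fq[X]) :
    ∃ b : ℕ → Fq[X], a = ∑ j ∈ Finset.range p, X ^ j * b j ^ p := by
  have hp : 0 < p := (Fact.out : p.Prime).pos
  induction a using Polynomial.induction_on' with
  | add f g hf hg =>
    obtain ⟨b, hb⟩ := hf
    obtain ⟨c, hc⟩ := hg
    refine ⟨fun j => b j + c j, ?_⟩
    nth_rewrite 1 [hb, hc]
    rw [← Finset.sum_add_distrib]
    refine Finset.sum_congr rfl fun j _ => ?_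
    rw [add_pow_char, mul_add]
  | monomial n c =>
    obtain ⟨d, hd⟩ := surjective_frobenius Fq p c
    refine ⟨fun j => if j = n % p then monomial (n / p) d else 0, ?_⟩
    rw [Finset.sum_eq_single (n % p)]
    · beta_reduce
      rw [if_pos rfl, monomial_pow, ← monomial_one_right_eq_X_pow, monomial_mul_monomial, one_mul,
        Nat.mod_add_div' n p]
      congr 1
      rw [← hd]; rfl
    · intro j _ hj
      beta_reduce
      rw [if_neg hj, zero_pow hp.ne', mul_zero]
    · intro h
      exact absurd (Finset.mem_range.2 (Nat.mod_lt n hp)) h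

lemma pdecomp2 (p : ℕ) [Fact p.Prime] [CharP Fq p] {Q : Fq[X][X]} (hQ : derivative Q = 0) :
    ∃ R : ℕ → Fq[X][X], (Q = ∑ j ∈ Finset.range p, C (X ^ j) * R j ^ p) ∧
      (∀ j, (R j).natDegree * p ≤ Q.natDegree) ∧
      (∀ i, Q.coeff (i * p) = ∑ j ∈ Finset.range p, X ^ j * ((R j).coeff i) ^ p) := by
  have hp : p ≠ 0 := (Fact.out : p.Prime).ne_zero
  choose b hb using pdecomp (Fq := Fq) p
  set G := contract p Q with hG
  have hGQ : expand _ p G = Q := expand_contract p hQ hp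
  have hdeg : Q.natDegree = G.natDegree * p := by rw [← hGQ, natDegree_expand]
  let R : ℕ → Fq[X][X] := fun j =>
    ∑ i ∈ Finset.range (G.natDegree + 1), monomial i (b (G.coeff i) j)
  have hQR : Q = ∑ j ∈ Finset.range p, C (X ^ j) * R j ^ p := by
    rw [← hGQ]
    conv_lhs => rw [as_sum_range G, map_sum]
    simp only [R, sum_pow_char, Finset.mul_sum, expand_monomial]
    rw [Finset.sum_comm]
    refine Finset.sum_congr rfl fun i _ => ?_
    conv_lhs => rw [hb (G.coeff i), map_sum]
    refine Finset.sum_congr rfl fun j _ => ?_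
    rw [monomial_pow, C_mul_monomial]
  refine ⟨R, hQR, ?_, ?_⟩
  · intro j
    rw [hdeg]
    apply Nat.mul_le_mul_right
    apply natDegree_sum_le_of_forall_le
    intro i hi
    exact (natDegree_monomial_le _).trans (by simp at hi; omega)
  · intro i
    have hexp : ∀ f : Fq[X][X], (f ^ p).coeff (i * p) = f.coeff i ^ p := by
      intro f
      conv_lhs => rw [as_sum_range f, sum_pow_char, finsetSum_coeff]
      simp only [monomial_pow, coeff_monomial]
      rw [Finset.sum_eq_single i]
      · simp
      · intro k _ hk
        rw [if_neg]
        intro h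
        exact hk (Nat.eq_of_mul_eq_mul_right (Nat.pos_of_ne_zero hp) h)
      · intro h
        rw [coeff_eq_zero_of_natDegree_lt (by simpa using h)]
        simp [hp]
    conv_lhs => rw [hQR, finsetSum_coeff]
    simp only [coeff_C_mul, hexp]

lemma absK_le_sum {ι : Type*} (s : Finset ι) (z : ι → K Fq)
    (h : ∀ i ∈ s, ∀ j ∈ s, z i ≠ 0 → absK Fq (z i) = absK Fq (z j) → i = j) :
    ∀ i ∈ s, absK Fq (z i) ≤ absK Fq (∑ j ∈ s, z j) := by
  intro i hi
  obtain ⟨k, hk, hmax⟩ := Finset.exists_max_image s (fun j => absK Fq (z j)) ⟨i, hi⟩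
  by_cases hz : z k = 0
  · have := hmax i hi
    rw [hz, absK_zero] at this
    exact this.trans (absK_nonneg _)
  refine (hmax i hi).trans ?_
  rw [← Finset.add_sum_erase s z hk, absK_add_eq_left]
  apply absK_sum_lt _ _ (absK_pos hz)
  intro j hj
  simp only [Finset.mem_erase] at hj
  refine lt_of_le_of_ne (hmax j hj.2) fun hc => hj.1 (h k hk j hj.2 hz hc.symm).symm

lemma absK_le_psum (p : ℕ) (hp : 0 < p) (y : ℕ → K Fq) :
    ∀ i ∈ Finset.range p, absK Fq (y i) ^ p ≤
      absK Fq (∑ j ∈ Finset.range p, Tvar Fq ^ j * y j ^ p) := by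
  intro i hi
  refine le_trans ?_ (absK_le_sum (Finset.range p) (fun j => Tvar Fq ^ j * y j ^ p) ?_ i hi)
  · simp only [absK_mul, absK_pow, absK_Tvar]
    exact le_mul_of_one_le_left (pow_nonneg (absK_nonneg _) _) (one_le_pow₀ one_lt_q.le)
  · intro i hi j hj hz he
    have hT : (Tvar Fq) ≠ 0 := by simp [Tvar]
    have hyi : y i ≠ 0 := fun h => hz (by simp [h, hp.ne'])
    have hz' : Tvar Fq ^ j * y j ^ p ≠ 0 := by
      rw [← absK_pos_iff, ← he]; exact absK_pos hz
    have hyj : y j ≠ 0 := fun h => hz' (by simp [h, hp.ne'])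
    simp only [absK_mul, absK_pow, absK_Tvar, absK_of_ne hyi, absK_of_ne hyj] at he
    rw [← zpow_natCast, ← zpow_natCast, ← zpow_natCast, ← zpow_natCast, ← zpow_mul, ← zpow_mul,
      ← zpow_add₀ q_pos.ne', ← zpow_add₀ q_pos.ne'] at he
    have he2 := zpow_right_injective₀ q_pos (one_lt_q (Fq := Fq)).ne' he
    have hdvd : (p : ℤ) ∣ (i : ℤ) - j :=
      ⟨(y i).order - (y j).order, by linear_combination he2⟩
    simp only [Finset.mem_range] at hi hj
    have := Int.eq_zero_of_abs_lt_dvd hdvd (by rw [abs_lt]; constructor <;> omega)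
    omega

lemma emb_X : emb Fq X = Tvar Fq := eval₂_X _ _

lemma evalK_psum (p : ℕ) (R : ℕ → Fq[X][X]) (ξ : K Fq) :
    evalK Fq (∑ j ∈ Finset.range p, C (X ^ j) * R j ^ p) ξ =
      ∑ j ∈ Finset.range p, Tvar Fq ^ j * (evalK Fq (R j) ξ) ^ p := by
  unfold evalK
  rw [eval₂_finsetSum]
  refine Finset.sum_congr rfl fun j _ => ?_
  rw [eval₂_mul, eval₂_C, map_pow, emb_X, eval₂_pow]

lemma exists_sep_factor {ξ : K Fq} {w δ : ℝ} (hw : 0 ≤ w) (hδ : 0 < δ) (hδ1 : δ ≤ 1) (n : ℕ) :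
    ∀ P : Fq[X][X], P.natDegree ≤ n → 0 < absK Fq (evalK Fq P ξ) →
    absK Fq (evalK Fq P ξ) < δ ^ P.natDegree * HP Fq P ^ (-w) →
    ∃ Q : Fq[X][X], Irreducible Q ∧ 0 < Q.natDegree ∧ Q.natDegree ≤ n ∧ derivative Q ≠ 0 ∧
      0 < absK Fq (evalK Fq Q ξ) ∧
      absK Fq (evalK Fq Q ξ) < δ ^ Q.natDegree * HP Fq Q ^ (-w) := by
  induction n using Nat.strong_induction_on with
  | _ n ih =>
  intro P hPn h0 h
  obtain ⟨Q, hQ, hQ0, hQn, hQ1, hQ2⟩ := exists_factor hw hδ h0 h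
  by_cases hd : derivative Q = 0
  swap
  · exact ⟨Q, hQ, hQ0, hQn.trans hPn, hd, hQ1, hQ2⟩
  obtain ⟨p, hp⟩ := CharP.exists Fq
  have : Fact p.Prime := ⟨CharP.char_is_prime Fq p⟩
  have hp1 : 1 < p := (Fact.out : p.Prime).one_lt
  obtain ⟨R, hR1, hR2, hR3⟩ := pdecomp2 p hd
  have hev := evalK_psum p R ξ
  rw [← hR1] at hev
  obtain ⟨j, hj, hjne⟩ : ∃ j ∈ Finset.range p, evalK Fq (R j) ξ ≠ 0 := by
    by_contra hc
    push Not at hc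
    rw [hev, Finset.sum_eq_zero, absK_zero] at hQ1
    · exact lt_irrefl _ hQ1
    · intro j hj
      rw [hc j hj, zero_pow (by omega), mul_zero]
  have hle : absK Fq (evalK Fq (R j) ξ) ^ p ≤ absK Fq (evalK Fq Q ξ) := by
    rw [hev]; exact absK_le_psum p (by omega) (fun j => evalK Fq (R j) ξ) j hj
  have hHle : HP Fq (R j) ^ p ≤ HP Fq Q := by
    have hB : (HP Fq Q ^ ((p : ℝ)⁻¹)) ^ p = HP Fq Q :=
      Real.rpow_inv_natCast_pow (HP_pos Q).le (show p ≠ 0 by omega)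
    rw [← hB]
    apply pow_le_pow_left₀ (HP_pos (R j)).le
    refine HP_le (R j) ?_ ?_
    · exact Real.one_le_rpow (one_le_HP Q) (by positivity)
    · intro i
      rw [← pow_le_pow_iff_left₀ (absK_nonneg _) (Real.rpow_nonneg (HP_pos Q).le _)
        (show p ≠ 0 by omega), hB]
      refine (absK_le_psum p (by omega) (fun j => emb Fq ((R j).coeff i)) j hj).trans ?_
      have : ∑ j ∈ Finset.range p, Tvar Fq ^ j * (emb Fq ((R j).coeff i)) ^ p =
          emb Fq (Q.coeff (i * p)) := by
        rw [hR3, map_sum]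
        simp [emb_X]
      rw [this]
      exact absK_coeff_le Q _
  have hdR : (R j).natDegree < Q.natDegree := by
    have := hR2 j
    by_contra hc
    push Not at hc
    have h5 : Q.natDegree * p ≤ Q.natDegree := (Nat.mul_le_mul_right p hc).trans this
    nlinarith
  have hfin : absK Fq (evalK Fq (R j) ξ) < δ ^ (R j).natDegree * HP Fq (R j) ^ (-w) := by
    apply lt_of_pow_lt_pow_left₀ p
      (mul_nonneg (pow_nonneg hδ.le _) (Real.rpow_nonneg (HP_pos (R j)).le _))
    refine lt_of_le_of_lt hle (hQ2.trans_le ?_)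
    rw [mul_pow, ← pow_mul]
    apply mul_le_mul
    · exact pow_le_pow_of_le_one hδ.le hδ1 (hR2 j)
    · rw [← Real.rpow_natCast, ← Real.rpow_mul (HP_pos (R j)).le, mul_comm,
        Real.rpow_mul (HP_pos (R j)).le, Real.rpow_natCast]
      exact Real.rpow_le_rpow_of_nonpos (pow_pos (HP_pos (R j)) _) hHle (by linarith)
    · exact Real.rpow_nonneg (HP_pos Q).le _
    · exact pow_nonneg hδ.le _
  obtain ⟨S, s1, s2, s3, s4⟩ := ih (R j).natDegree (by omega) (R j) le_rfl (absK_pos hjne) hfin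
  exact ⟨S, s1, s2, by omega, s4⟩

set_option linter.unusedSectionVars false
/-! ### Reformulation of the exponents -/

/-- A smooth version of `w ≤ w_n(ξ)`. -/
def GP (ξ : K Fq) (n : ℕ) (w : ℝ) : Prop := ∀ δ : ℝ, 0 < δ → ∃ P : Fq[X][X], P.natDegree ≤ n ∧
  0 < absK Fq (evalK Fq P ξ) ∧ absK Fq (evalK Fq P ξ) < δ * HP Fq P ^ (-w)

/-- A smooth version of `w ≤ w_n^*(ξ)`. -/
def GS (ξ : K Fq) (n : ℕ) (w : ℝ) : Prop := ∀ δ : ℝ, 0 < δ → ∃ α : K Fq, IsAlgK Fq α ∧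
  degA Fq α ≤ n ∧ 0 < absK Fq (ξ - α) ∧ absK Fq (ξ - α) < δ * HA Fq α ^ (-w - 1)

lemma exists_lower {ι : Type*} {S : Set ι} (hS : S.Finite) (f : ι → ℝ) (hf : ∀ i ∈ S, 0 < f i) :
    ∃ δ : ℝ, 0 < δ ∧ δ ≤ 1 ∧ ∀ i ∈ S, δ ≤ f i := by
  induction S, hS using Set.Finite.induction_on with
  | empty => exact ⟨1, one_pos, le_rfl, by simp⟩
  | @insert a s _ _ ih =>
    obtain ⟨δ, h1, h2, h3⟩ := ih fun i hi => hf i (Set.mem_insert_of_mem _ hi)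
    refine ⟨min δ (f a), lt_min h1 (hf a (Set.mem_insert _ _)), (min_le_left _ _).trans h2, ?_⟩
    rintro i (rfl | hi)
    · exact min_le_right _ _
    · exact (min_le_left _ _).trans (h3 i hi)

lemma exists_large {ε δ : ℝ} (hε : 0 < ε) (hδ : 0 < δ) :
    ∃ B : ℝ, ∀ H, 1 ≤ H → B < H → H ^ (-ε) < δ := by
  have := (tendsto_rpow_neg_atTop hε).eventually (gt_mem_nhds hδ)
  obtain ⟨B, hB⟩ := Filter.eventually_atTop.1 this
  exact ⟨B, fun H _ hH => hB H hH.le⟩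

lemma le_wn {ξ : K Fq} {n : ℕ} {w : ℝ} (hw : 0 ≤ w) (h : GP ξ n w) : (w : EReal) ≤ wn Fq ξ n := by
  refine le_sSup ⟨w, ?_, rfl⟩
  intro hfin
  obtain ⟨δ, h1, h2, h3⟩ := exists_lower hfin (fun P => absK Fq (evalK Fq P ξ))
    (fun P hP => hP.2.1)
  obtain ⟨P, p1, p2, p3⟩ := h δ h1
  have h4 : δ * HP Fq P ^ (-w) ≤ HP Fq P ^ (-w) :=
    mul_le_of_le_one_left (Real.rpow_nonneg (HP_pos P).le _) h2
  have h5 := h3 P ⟨p1, p2, p3.trans_le h4⟩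
  have h6 : δ * HP Fq P ^ (-w) ≤ δ := mul_le_of_le_one_right h1.le (HP_rpow_le_one P hw)
  linarith

lemma le_wnstar {ξ : K Fq} {n : ℕ} {w : ℝ} (hw : -1 ≤ w) (h : GS ξ n w) :
    (w : EReal) ≤ wnstar Fq ξ n := by
  refine le_sSup ⟨w, ?_, rfl⟩
  intro hfin
  obtain ⟨δ, h1, h2, h3⟩ := exists_lower hfin (fun α => absK Fq (ξ - α))
    (fun P hP => hP.2.2.1)
  obtain ⟨P, p0, p1, p2, p3⟩ := h δ h1
  have hH := one_le_HA p0
  have h4 : δ * HA Fq P ^ (-w - 1) ≤ HA Fq P ^ (-w - 1) :=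
    mul_le_of_le_one_left (Real.rpow_nonneg (by linarith) _) h2
  have h5 := h3 P ⟨p0, p1, p2, p3.trans_le h4⟩
  have h6 : δ * HA Fq P ^ (-w - 1) ≤ δ := mul_le_of_le_one_right h1.le
    (Real.rpow_le_one_of_one_le_of_nonpos hH (by linarith))
  linarith

lemma GP_of_lt {ξ : K Fq} {n : ℕ} {w : ℝ} (h : (w : EReal) < wn Fq ξ n) : GP ξ n w := by
  obtain ⟨_, ⟨v, hv, rfl⟩, hwv⟩ := lt_sSup_iff.1 h
  have hwv : w < v := EReal.coe_lt_coe_iff.1 hwv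
  intro δ hδ
  obtain ⟨B, hB⟩ := exists_large (sub_pos.2 hwv) hδ
  obtain ⟨P, ⟨p1, p2, p3⟩, p4⟩ := (hv.sdiff (finite_HP_le (Fq := Fq) n B)).nonempty
  have hlt : B < HP Fq P := by
    by_contra hc
    exact p4 ⟨p1, not_lt.1 hc⟩
  refine ⟨P, p1, p2, p3.trans_le ?_⟩
  have h1 := hB _ (one_le_HP P) hlt
  have h2 : HP Fq P ^ (-v) = HP Fq P ^ (-(v - w)) * HP Fq P ^ (-w) := by
    rw [← Real.rpow_add (HP_pos P)]; ring_nf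
  rw [h2]
  exact mul_le_mul_of_nonneg_right h1.le (Real.rpow_nonneg (HP_pos P).le _)

lemma GS_of_lt {ξ : K Fq} {n : ℕ} {w : ℝ} (h : (w : EReal) < wnstar Fq ξ n) : GS ξ n w := by
  obtain ⟨_, ⟨v, hv, rfl⟩, hwv⟩ := lt_sSup_iff.1 h
  have hwv : w < v := EReal.coe_lt_coe_iff.1 hwv
  intro δ hδ
  obtain ⟨B, hB⟩ := exists_large (sub_pos.2 hwv) hδ
  obtain ⟨P, ⟨p0, p1, p2, p3⟩, p4⟩ := (hv.sdiff (finite_HA_le (Fq := Fq) n B)).nonempty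
  have hlt : B < HA Fq P := by
    by_contra hc
    exact p4 ⟨p0, p1, not_lt.1 hc⟩
  refine ⟨P, p0, p1, p2, p3.trans_le ?_⟩
  have hpos : 0 < HA Fq P := lt_of_lt_of_le one_pos (one_le_HA p0)
  have h1 := hB _ (one_le_HA p0) hlt
  have h2 : HA Fq P ^ (-v - 1) = HA Fq P ^ (-(v - w)) * HA Fq P ^ (-w - 1) := by
    rw [← Real.rpow_add hpos]; ring_nf
  rw [h2]
  exact mul_le_mul_of_nonneg_right h1.le (Real.rpow_nonneg hpos.le _)

/-! ### From algebraic approximation to polynomial approximation -/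

lemma GP_of_GS {ξ : K Fq} {n : ℕ} {w : ℝ} (hw : 0 ≤ w) (h : GS ξ n w) : GP ξ n w := by
  obtain ⟨ρ, hρ0, hρ1, hρ⟩ : ∃ ρ : ℝ, 0 < ρ ∧ ρ ≤ 1 ∧ ∀ (Q : Fq[X][X]) (α : K Fq),
      Irreducible Q → evalK Fq Q α = 0 → evalK Fq Q ξ = 0 → α ≠ ξ → ρ ≤ absK Fq (ξ - α) := by
    by_cases hξ : IsAlgK Fq ξ
    · obtain ⟨M, hM, hM0⟩ := hξ
      obtain ⟨ρ, h1, h2, h3⟩ := exists_lower ((finite_roots hM).sdiff (t := {ξ}))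
        (fun α => absK Fq (ξ - α)) (fun α hα => absK_pos (sub_ne_zero.2 fun h => hα.2 h.symm))
      refine ⟨ρ, h1, h2, fun Q α hQ hα hξ hne => h3 α ⟨?_, hne⟩⟩
      obtain ⟨R, hR⟩ := dvd_of_root hQ hξ hM0
      change evalK Fq M α = 0
      rw [hR, evalK_mul, hα, zero_mul]
    · exact ⟨1, one_pos, le_rfl, fun Q α hQ _ h _ => absurd ⟨Q, hQ.ne_zero, h⟩ hξ⟩
  intro δ hδ
  have hM := mx_pos ξ
  obtain ⟨α, a1, a2, a3, a4⟩ := h (min ρ (δ / mx ξ ^ n)) (lt_min hρ0 (by positivity))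
  obtain ⟨P, hP, hPd, hP0, hPH⟩ := exists_HA a1
  obtain ⟨Q, hQ, hQP, hQ0⟩ := exists_irreducible_root hP hP0
  have hQH : HP Fq Q = HA Fq α := le_antisymm (hPH ▸ HP_le_of_dvd hP hQP) (HA_le hQ.ne_zero hQ0)
  have hHA : 1 ≤ HA Fq α := one_le_HA a1
  have hHA0 : 0 < HA Fq α := by linarith
  have hQd : Q.natDegree ≤ n := by rw [← degA_eq hQ hQ0]; exact a2
  have hsm : absK Fq (ξ - α) < ρ := a4.trans_le ((mul_le_of_le_one_right
    (lt_min hρ0 (by positivity)).le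
    (Real.rpow_le_one_of_one_le_of_nonpos hHA (by linarith))).trans (min_le_left _ _))
  have hαM : absK Fq α ≤ mx ξ := by
    have : α = ξ - (ξ - α) := by ring
    rw [this]
    exact absK_sub_le_of (absK_le_mx ξ) ((hsm.le.trans hρ1).trans (one_le_mx ξ))
  refine ⟨Q, hQd, ?_, ?_⟩
  · rw [absK_pos_iff]
    intro hc
    have hne : α ≠ ξ := by
      rintro rfl
      simp [absK_zero] at a3
    exact absurd (hρ Q α hQ hQ0 hc hne) (not_le.2 hsm)
  · have h1 : absK Fq (evalK Fq Q ξ) ≤ HP Fq Q * mx ξ ^ n * absK Fq (ξ - α) := by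
      have := absK_eval_sub_le (Q.map (emb Fq)) (x := ξ) (y := α) (n := n)
        (by rw [natDegree_map_emb]; exact hQd) (B := HP Fq Q) (M := mx ξ)
        (fun i => by rw [coeff_map]; exact absK_coeff_le Q i) (one_le_mx ξ) (absK_le_mx ξ) hαM
      rw [← evalK_eq, ← evalK_eq, hQ0, sub_zero] at this
      exact this
    refine lt_of_le_of_lt h1 ?_
    rw [hQH]
    calc HA Fq α * mx ξ ^ n * absK Fq (ξ - α)
        < HA Fq α * mx ξ ^ n * (δ / mx ξ ^ n * HA Fq α ^ (-w - 1)) := by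
          apply mul_lt_mul_of_pos_left _ (by positivity)
          exact a4.trans_le (mul_le_mul_of_nonneg_right (min_le_right _ _)
            (Real.rpow_nonneg hHA0.le _))
      _ = δ * (HA Fq α ^ (1 : ℝ) * HA Fq α ^ (-w - 1)) := by
          rw [Real.rpow_one]; field_simp
      _ = δ * HA Fq α ^ (-w) := by
          rw [← Real.rpow_add hHA0]; ring_nf

/-! ### Liouville's inequality -/

lemma liouville {ξ : K Fq} (hξ : IsAlgK Fq ξ) : ∃ d : ℕ, ∀ n, wn Fq ξ n ≤ ((d : ℝ) : EReal) := by
  obtain ⟨P0, hP0, h0⟩ := hξ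
  obtain ⟨M, hM, -, hM0⟩ := exists_irreducible_root hP0 h0
  have hMd := natDegree_pos_of_root hM.ne_zero hM0
  refine ⟨M.natDegree, fun n => ?_⟩
  by_contra hc
  push Not at hc
  have hG := GP_of_lt hc
  have hmx := mx_pos ξ
  have hHM := HP_pos M
  obtain ⟨P, p1, p2, p3⟩ := hG (mx ξ ^ (M.natDegree + n) * HP Fq M ^ n)⁻¹ (by positivity)
  have hHP := HP_pos P
  have hnd : ¬ M ∣ P := by
    rintro ⟨R, rfl⟩
    rw [evalK_mul, hM0, zero_mul, absK_zero] at p2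
    exact lt_irrefl _ p2
  have hr := resultant_bound (coprime_of_not_dvd hM hMd hnd) hMd ξ (le_refl (HP Fq M))
    (le_refl (HP Fq P)) (ε := absK Fq (evalK Fq P ξ) / HP Fq P)
    (by rw [hM0, absK_zero]; positivity) (by field_simp; exact le_rfl)
  set d := M.natDegree
  have h1 : mx ξ ^ (d + P.natDegree) ≤ mx ξ ^ (d + n) :=
    pow_le_pow_right₀ (one_le_mx ξ) (by omega)
  have h2 : HP Fq M ^ P.natDegree ≤ HP Fq M ^ n := pow_le_pow_right₀ (one_le_HP M) p1
  have h3 : absK Fq (evalK Fq P ξ) / HP Fq P ≤ absK Fq (evalK Fq P ξ) :=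
    div_le_self p2.le (one_le_HP P)
  have h4 : (1 : ℝ) ≤ absK Fq (evalK Fq P ξ) * mx ξ ^ (d + n) * (HP Fq P ^ d * HP Fq M ^ n) := by
    refine hr.trans ?_
    gcongr
  have h5 : absK Fq (evalK Fq P ξ) * mx ξ ^ (d + n) * (HP Fq P ^ d * HP Fq M ^ n) <
      (mx ξ ^ (d + n) * HP Fq M ^ n)⁻¹ * HP Fq P ^ (-(d : ℝ)) * mx ξ ^ (d + n) *
        (HP Fq P ^ d * HP Fq M ^ n) := by
    gcongr
  have h6 : (mx ξ ^ (d + n) * HP Fq M ^ n)⁻¹ * HP Fq P ^ (-(d : ℝ)) * mx ξ ^ (d + n) *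
        (HP Fq P ^ d * HP Fq M ^ n) = 1 := by
    rw [Real.rpow_neg hHP.le, Real.rpow_natCast]
    field_simp
  linarith

set_option linter.unusedSectionVars false
/-! ### From polynomial approximation to algebraic approximation -/

lemma derivative_map_eval (Q : Fq[X][X]) (ξ : K Fq) :
    (derivative (Q.map (emb Fq))).eval ξ = evalK Fq (derivative Q) ξ := by
  rw [evalK_eq, derivative_map]

lemma HP_derivative_le (Q : Fq[X][X]) : HP Fq (derivative Q) ≤ HP Fq Q := by
  apply HP_le _ (one_le_HP Q)
  intro i
  rw [coeff_derivative, map_mul, absK_mul]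
  have h1 : absK Fq (emb Fq ((i : Fq[X]) + 1)) ≤ 1 := by
    have := absK_natCast_le (Fq := Fq) (i + 1)
    simpa using this
  exact (mul_le_of_le_one_right (absK_nonneg _) h1).trans (absK_coeff_le Q _)

lemma hensel_alg {R : Fq[X][X]} {ξ : K Fq} {n : ℕ} (hn : R.natDegree ≤ n)
    (h : absK Fq (evalK Fq R ξ) * (HP Fq R * mx ξ ^ n) < absK Fq (evalK Fq (derivative R) ξ) ^ 2)
    (h0 : 0 < absK Fq (evalK Fq R ξ)) :
    ∃ α : K Fq, IsAlgK Fq α ∧ degA Fq α ≤ n ∧ 0 < absK Fq (ξ - α) ∧ HA Fq α ≤ HP Fq R ∧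
      absK Fq (ξ - α) ≤ absK Fq (evalK Fq R ξ) / absK Fq (evalK Fq (derivative R) ξ) := by
  have hR : R ≠ 0 := ne_zero_of_eval_pos h0
  obtain ⟨α, h1, h2⟩ := hensel (R.map (emb Fq)) ξ (n := n) (by rwa [natDegree_map_emb])
    (B := HP Fq R) (fun i => by rw [coeff_map]; exact absK_coeff_le R i)
    (by rw [derivative_map_eval, ← evalK_eq]; exact h)
  rw [derivative_map_eval, ← evalK_eq] at h2
  rw [← evalK_eq] at h1
  refine ⟨α, ⟨R, hR, h1⟩, (degA_le hR h1).trans hn, ?_, HA_le hR h1, h2⟩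
  apply absK_pos
  intro hc
  rw [sub_eq_zero.1 hc, h1, absK_zero] at h0
  exact lt_irrefl _ h0

lemma GS_of_GP {ξ : K Fq} {n : ℕ} (hn : 1 ≤ n) {w : ℝ} (hw : 4 * (n : ℝ) + 2 ≤ w)
    (h : GP ξ n w) : GS ξ n (w - 2 * n - 1) := by
  intro δ hδ
  have hmx := mx_pos ξ
  have hmx1 := one_le_mx ξ
  have hn0 : (0 : ℝ) ≤ n := Nat.cast_nonneg n
  set M := mx ξ with hM
  obtain ⟨δ1, hδ0, hδ1, hδ2, hδ3⟩ : ∃ δ1 : ℝ, 0 < δ1 ∧ δ1 ≤ 1 ∧ δ1 * M ^ (5 * n) ≤ 1 ∧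
      δ1 * M ^ (2 * n) ≤ δ := by
    refine ⟨min (1 / M ^ (5 * n)) (δ / M ^ (2 * n)), lt_min (by positivity) (by positivity),
      (min_le_left _ _).trans ?_, ?_, ?_⟩
    · rw [div_le_one (by positivity)]; exact one_le_pow₀ hmx1
    · rw [← le_div_iff₀ (by positivity)]; exact min_le_left _ _
    · rw [← le_div_iff₀ (by positivity)]; exact min_le_right _ _
  obtain ⟨P, p1, p2, p3⟩ := h (δ1 ^ n) (by positivity)
  have hw0 : 0 ≤ w := by linarith
  obtain ⟨Q, q1, q2, q3, q4, q5, q6⟩ := exists_sep_factor hw0 hδ0 hδ1 n P p1 p2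
    (p3.trans_le (mul_le_mul_of_nonneg_right (pow_le_pow_of_le_one hδ0.le hδ1 p1)
      (Real.rpow_nonneg (HP_pos P).le _)))
  have hH0 := HP_pos Q
  have hH1 := one_le_HP Q
  have q7 : absK Fq (evalK Fq Q ξ) < δ1 * HP Fq Q ^ (-w) := by
    refine q6.trans_le (mul_le_mul_of_nonneg_right ?_ (Real.rpow_nonneg hH0.le _))
    calc δ1 ^ Q.natDegree ≤ δ1 ^ 1 := pow_le_pow_of_le_one hδ0.le hδ1 q2
      _ = δ1 := pow_one _
  set H := HP Fq Q with hH
  have hnd : ¬ Q ∣ derivative Q := by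
    intro hd
    have h1 := natDegree_le_of_dvd hd q4
    have h2 := natDegree_derivative_lt q2.ne'
    omega
  have hr := resultant_bound (coprime_of_not_dvd q1 q2 hnd) q2 ξ (le_refl H)
    (HP_derivative_le Q)
    (ε := max (absK Fq (evalK Fq Q ξ)) (absK Fq (evalK Fq (derivative Q) ξ)) / H)
    (by rw [div_mul_cancel₀ _ hH0.ne']; exact le_max_left _ _)
    (by rw [div_mul_cancel₀ _ hH0.ne']; exact le_max_right _ _)
  rw [← hM] at hr
  set A := absK Fq (evalK Fq Q ξ) with hA
  set A' := absK Fq (evalK Fq (derivative Q) ξ) with hA'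
  have hd : (derivative Q).natDegree ≤ n := (natDegree_derivative_le Q).trans (by omega)
  have hA'0 : 0 ≤ A' := absK_nonneg _
  have hmax : 0 ≤ max A A' := le_max_of_le_right hA'0
  -- the main lower bound
  have h1 : 1 ≤ max A A' * (M ^ (2 * n) * H ^ (2 * n)) := by
    refine hr.trans ?_
    rw [← pow_add]
    have e1 : M ^ (Q.natDegree + (derivative Q).natDegree) ≤ M ^ (2 * n) :=
      pow_le_pow_right₀ hmx1 (by omega)
    have e2 : H ^ (Q.natDegree + (derivative Q).natDegree) ≤ H ^ (2 * n) :=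
      pow_le_pow_right₀ hH1 (by omega)
    have e3 : max A A' / H ≤ max A A' := div_le_self hmax hH1
    rw [mul_assoc]
    gcongr
  have hHw : H ^ (-w) * H ^ (4 * n + 1) ≤ 1 := by
    rw [← Real.rpow_natCast, ← Real.rpow_add hH0]
    apply Real.rpow_le_one_of_one_le_of_nonpos hH1
    push_cast
    linarith
  have hHw2 : H ^ (-w) * H ^ (2 * n) ≤ 1 := by
    refine le_trans ?_ hHw
    gcongr
    omega
  have hM25 : M ^ (2 * n) ≤ M ^ (5 * n) := pow_le_pow_right₀ hmx1 (by omega)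
  have h2 : 1 ≤ A' * (M ^ (2 * n) * H ^ (2 * n)) := by
    rcases le_total A A' with hc | hc
    · rwa [max_eq_right hc] at h1
    · rw [max_eq_left hc] at h1
      exfalso
      have e1 : A * (M ^ (2 * n) * H ^ (2 * n)) <
          δ1 * H ^ (-w) * (M ^ (2 * n) * H ^ (2 * n)) := by gcongr
      have e2 : δ1 * H ^ (-w) * (M ^ (2 * n) * H ^ (2 * n)) =
          (δ1 * M ^ (2 * n)) * (H ^ (-w) * H ^ (2 * n)) := by ring
      have e3 : δ1 * M ^ (2 * n) ≤ 1 := le_trans (by gcongr) hδ2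
      have e4 : (δ1 * M ^ (2 * n)) * (H ^ (-w) * H ^ (2 * n)) ≤ 1 :=
        mul_le_one₀ e3 (by positivity) hHw2
      linarith
  have hA'pos : 0 < A' := by
    rcases hA'0.eq_or_lt with hc | hc
    · rw [← hc, zero_mul] at h2; linarith
    · exact hc
  have hX : 0 < M ^ (2 * n) * H ^ (2 * n) := by positivity
  have h3 : A * (H * M ^ n) < A' ^ 2 := by
    have e1 : 1 ≤ A' ^ 2 * (M ^ (2 * n) * H ^ (2 * n)) ^ 2 := by
      rw [← mul_pow]; exact one_le_pow₀ h2
    have e2 : A * (H * M ^ n) * (M ^ (2 * n) * H ^ (2 * n)) ^ 2 < 1 := by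
      calc A * (H * M ^ n) * (M ^ (2 * n) * H ^ (2 * n)) ^ 2
          < δ1 * H ^ (-w) * (H * M ^ n) * (M ^ (2 * n) * H ^ (2 * n)) ^ 2 := by gcongr
        _ = (δ1 * M ^ (5 * n)) * (H ^ (-w) * H ^ (4 * n + 1)) := by ring
        _ ≤ 1 := mul_le_one₀ hδ2 (by positivity) hHw
    exact lt_of_mul_lt_mul_right (e2.trans_le e1) (by positivity)
  obtain ⟨α, a1, a2, a3, a4, a5⟩ := hensel_alg q3 h3 q5
  refine ⟨α, a1, a2, a3, lt_of_le_of_lt a5 ?_⟩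
  have hHA := one_le_HA a1
  have h4 : H ^ (-(w - 2 * n - 1) - 1) ≤ HA Fq α ^ (-(w - 2 * n - 1) - 1) :=
    Real.rpow_le_rpow_of_nonpos (by linarith) a4 (by linarith)
  refine lt_of_lt_of_le ?_ (mul_le_mul_of_nonneg_left h4 hδ.le)
  have h5 : H ^ (-(w - 2 * n - 1) - 1) = H ^ (-w) * H ^ (2 * n) := by
    rw [← Real.rpow_natCast, ← Real.rpow_add hH0]; push_cast; ring_nf
  rw [h5, div_lt_iff₀ hA'pos]
  calc A < δ1 * H ^ (-w) := q7
    _ ≤ δ1 * H ^ (-w) * (A' * (M ^ (2 * n) * H ^ (2 * n))) :=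
        le_mul_of_one_le_right (by positivity) h2
    _ = (δ1 * M ^ (2 * n)) * (H ^ (-w) * H ^ (2 * n)) * A' := by ring
    _ ≤ δ * (H ^ (-w) * H ^ (2 * n)) * A' := by gcongr

set_option linter.unusedSectionVars false
/-! ### Dirichlet's theorem -/

/-- The polynomial with a given table of coefficients. -/
def tab (h D : ℕ) (c : Fin (h + 1) × Fin (D + 1) → Fq) : Fq[X][X] :=
  ∑ i : Fin (h + 1), monomial i.1 (∑ j : Fin (D + 1), monomial j.1 (c (i, j)))

lemma tab_coeff (h D : ℕ) (c : Fin (h + 1) × Fin (D + 1) → Fq) (i : Fin (h + 1))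
    (j : Fin (D + 1)) : ((tab h D c).coeff i.1).coeff j.1 = c (i, j) := by
  have h1 : (tab h D c).coeff i.1 = ∑ j : Fin (D + 1), monomial j.1 (c (i, j)) := by
    rw [tab, finsetSum_coeff, Finset.sum_eq_single i]
    · simp
    · intro b _ hb
      rw [coeff_monomial, if_neg]
      exact fun h => hb (Fin.ext h)
    · simp
  rw [h1, finsetSum_coeff, Finset.sum_eq_single j]
  · simp
  · intro b _ hb
    rw [coeff_monomial, if_neg]
    exact fun h => hb (Fin.ext h)
  · simp

lemma tab_natDegree (h D : ℕ) (c : Fin (h + 1) × Fin (D + 1) → Fq) :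
    (tab h D c).natDegree ≤ h := by
  refine natDegree_sum_le_of_forall_le _ _ fun i _ => ?_
  exact (natDegree_monomial_le _).trans (by omega)

lemma tab_coeff_natDegree (h D : ℕ) (c : Fin (h + 1) × Fin (D + 1) → Fq) (i : ℕ) :
    ((tab h D c).coeff i).natDegree ≤ D := by
  rw [tab, finsetSum_coeff]
  refine natDegree_sum_le_of_forall_le _ _ fun k _ => ?_
  rw [coeff_monomial]
  split_ifs
  · refine natDegree_sum_le_of_forall_le _ _ fun i _ => ?_
    exact (natDegree_monomial_le _).trans (by omega)
  · simp

lemma evalK_sub (P Q : Fq[X][X]) (x : K Fq) :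
    evalK Fq (P - Q) x = evalK Fq P x - evalK Fq Q x := eval₂_sub _

lemma evalK_add (P Q : Fq[X][X]) (x : K Fq) :
    evalK Fq (P + Q) x = evalK Fq P x + evalK Fq Q x := eval₂_add _ _

lemma dirichlet (ξ : K Fq) (h : ℕ) : ∃ C : ℝ, 1 ≤ C ∧ ∀ D : ℕ, ∃ Q : Fq[X][X], Q ≠ 0 ∧
    Q.natDegree ≤ h ∧ hh Q ≤ D ∧
    absK Fq (evalK Fq Q ξ) * ((Fintype.card Fq : ℝ) ^ D) ^ h ≤ C := by
  obtain ⟨m, hm⟩ := pow_unbounded_of_one_lt (mx ξ) (one_lt_q (Fq := Fq))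
  set q : ℝ := (Fintype.card Fq : ℝ) with hq
  have hq1 : 1 < q := one_lt_q
  have hq0 : 0 < q := q_pos
  refine ⟨q ^ (m * h), one_le_pow₀ hq1.le, fun D => ?_⟩
  obtain ⟨N, hN⟩ : ∃ N : ℕ, N + 1 = (h + 1) * (D + 1) :=
    ⟨(h + 1) * (D + 1) - 1, Nat.sub_add_cancel (Nat.mul_pos (by omega) (by omega))⟩
  have hcard : Fintype.card (Fin N → Fq) < Fintype.card (Fin (h + 1) × Fin (D + 1) → Fq) := by
    rw [Fintype.card_fun, Fintype.card_fun, Fintype.card_prod, Fintype.card_fin, Fintype.card_fin,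
      Fintype.card_fin, ← hN]
    exact Nat.pow_lt_pow_right Fintype.one_lt_card (by omega)
  obtain ⟨c, c', hne, heq⟩ := Fintype.exists_ne_map_eq_of_card_lt
    (fun (c : Fin (h + 1) × Fin (D + 1) → Fq) (k : Fin N) =>
      (evalK Fq (tab h D c) ξ).coeff ((k.1 : ℤ) - (D + m * h : ℕ))) hcard
  refine ⟨tab h D c - tab h D c', ?_, ?_, ?_, ?_⟩
  · intro h0
    apply hne
    ext ⟨i, j⟩
    rw [← tab_coeff h D c, ← tab_coeff h D c', sub_eq_zero.1 h0]
  · exact (natDegree_sub_le _ _).trans (max_le (tab_natDegree _ _ _) (tab_natDegree _ _ _))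
  · rw [hh_le_iff]
    intro i
    rw [coeff_sub]
    exact (natDegree_sub_le _ _).trans
      (max_le (tab_coeff_natDegree _ _ _ _) (tab_coeff_natDegree _ _ _ _))
  · set Q := tab h D c - tab h D c' with hQ
    have hd : Q.natDegree ≤ h :=
      (natDegree_sub_le _ _).trans (max_le (tab_natDegree _ _ _) (tab_natDegree _ _ _))
    have hH : hh Q ≤ D := by
      rw [hh_le_iff]
      intro i
      rw [coeff_sub]
      exact (natDegree_sub_le _ _).trans
        (max_le (tab_coeff_natDegree _ _ _ _) (tab_coeff_natDegree _ _ _ _))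
    have h1 : absK Fq (evalK Fq Q ξ) ≤ q ^ (-(-((D + m * h : ℕ) : ℤ))) := by
      rw [neg_neg, zpow_natCast, pow_add, pow_mul]
      refine (absK_evalK_le Q ξ hd).trans ?_
      rw [HP_eq]
      have := mx_pos ξ
      gcongr
      exact hq1.le
    have h2 : absK Fq (evalK Fq Q ξ) ≤ q ^ (-((N : ℤ) - (D + m * h : ℕ))) := by
      rw [hq, absK_le_zpow_iff]
      rw [hq, absK_le_zpow_iff] at h1
      intro k hk
      by_cases hk' : k < -((D + m * h : ℕ) : ℤ)
      · exact h1 k hk'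
      · obtain ⟨l, hl⟩ := Int.eq_ofNat_of_zero_le (a := k + (D + m * h : ℕ)) (by omega)
        have := congrFun heq ⟨l, by omega⟩
        simp only [] at this
        have hkl : k = (l : ℤ) - (D + m * h : ℕ) := by omega
        rw [hQ, evalK_sub, HahnSeries.coeff_sub, hkl]
        exact sub_eq_zero.2 this
    calc absK Fq (evalK Fq Q ξ) * (q ^ D) ^ h
        ≤ q ^ (-((N : ℤ) - (D + m * h : ℕ))) * (q ^ D) ^ h := by gcongr
      _ = q ^ (-((N : ℤ) - (D + m * h : ℕ)) + (D * h : ℕ)) := by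
          rw [zpow_add₀ hq0.ne', zpow_natCast, pow_mul]
      _ ≤ q ^ ((m * h : ℕ) : ℤ) := by
          apply zpow_le_zpow_right₀ hq1.le
          have : (N : ℤ) + 1 = (h + 1) * (D + 1) := by exact_mod_cast hN
          push_cast
          nlinarith
      _ = q ^ (m * h) := zpow_natCast _ _

set_option linter.unusedSectionVars false
/-! ### Algebraic approximation to a transcendental element -/

lemma round_poly (F : (K Fq)[X]) {k : ℕ} (hF : F.natDegree ≤ k) : ∃ a : Fq[X][X],
    a.natDegree ≤ k ∧ ∀ i, absK Fq ((F - a.map (emb Fq)).coeff i) ≤ 1 := by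
  choose r hr using exists_round (Fq := Fq)
  refine ⟨∑ i ∈ Finset.range (k + 1), monomial i (r (F.coeff i)), ?_, ?_⟩
  · refine natDegree_sum_le_of_forall_le _ _ fun i hi => ?_
    rw [Finset.mem_range] at hi
    exact (natDegree_monomial_le _).trans (by omega)
  · intro i
    rw [coeff_sub, coeff_map, finsetSum_coeff]
    by_cases hi : i < k + 1
    · rw [Finset.sum_eq_single i]
      · rw [coeff_monomial, if_pos rfl]
        exact (hr _).le
      · intro b _ hb
        rw [coeff_monomial, if_neg hb]
      · intro h
        exact absurd (Finset.mem_range.2 hi) h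
    · rw [Finset.sum_eq_zero]
      · rw [coeff_eq_zero_of_natDegree_lt (by omega), map_zero, sub_zero, absK_zero]
        exact zero_le_one
      · intro b hb
        rw [Finset.mem_range] at hb
        rw [coeff_monomial, if_neg (by omega)]

lemma absK_coeff_mul_le {F G : (K Fq)[X]} {A B : ℝ} (hF : ∀ i, absK Fq (F.coeff i) ≤ A)
    (hG : ∀ i, absK Fq (G.coeff i) ≤ B) (i : ℕ) : absK Fq ((F * G).coeff i) ≤ A * B := by
  have hA : 0 ≤ A := (absK_nonneg _).trans (hF 0)
  have hB : 0 ≤ B := (absK_nonneg _).trans (hG 0)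
  rw [coeff_mul]
  refine absK_sum_le _ _ (mul_nonneg hA hB) fun x _ => ?_
  rw [absK_mul]
  exact mul_le_mul (hF _) (hG _) (absK_nonneg _) hA

lemma combine {P Q : Fq[X][X]} {h : ℕ} {ξ A : K Fq} {H ε : ℝ}
    (hc : IsCoprime (P.map (emb Fq)) (Q.map (emb Fq))) (hP0 : 0 < P.natDegree)
    (hQ0 : 0 < Q.natDegree) (hPh : P.natDegree ≤ h) (hQh : Q.natDegree ≤ h)
    (hPH : HP Fq P ≤ H) (hQH : HP Fq Q ≤ H)
    (hPε : absK Fq (evalK Fq P ξ) ≤ ε) (hQε : absK Fq (evalK Fq Q ξ) ≤ ε)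
    (hA : H * mx ξ ^ (2 * h) < absK Fq A) :
    ∃ R : Fq[X][X], R.natDegree ≤ 2 * h - 1 ∧ absK Fq (evalK Fq R ξ) ≤ mx ξ ^ h * ε ∧
      absK Fq (evalK Fq (derivative R) ξ) = absK Fq A ∧ HP Fq R ≤ absK Fq A * mx ξ := by
  have hM1 := one_le_mx ξ
  have hM0 := mx_pos ξ
  have hH1 : 1 ≤ H := (one_le_HP P).trans hPH
  have hε0 : 0 ≤ ε := (absK_nonneg _).trans hPε
  set p := P.map (emb Fq) with hp
  set q := Q.map (emb Fq) with hq
  have hpd : p.natDegree = P.natDegree := natDegree_map_emb P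
  have hqd : q.natDegree = Q.natDegree := natDegree_map_emb Q
  have hp0 : p ≠ 0 := by rintro h0; rw [h0, natDegree_zero] at hpd; omega
  have hpB : ∀ i, absK Fq (p.coeff i) ≤ H := fun i => by
    rw [hp, coeff_map]; exact (absK_coeff_le P i).trans hPH
  have hqB : ∀ i, absK Fq (q.coeff i) ≤ H := fun i => by
    rw [hq, coeff_map]; exact (absK_coeff_le Q i).trans hQH
  obtain ⟨u, v, huv⟩ := hc
  set L : (K Fq)[X] := C A * (X - C ξ) with hL
  obtain ⟨a, b, hab, hb⟩ : ∃ a b : (K Fq)[X], a * p + b * q = L ∧ b.natDegree < p.natDegree := by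
    refine ⟨L * u + q * ((L * v) / p), (L * v) % p, ?_, ?_⟩
    · have h1 := EuclideanDomain.div_add_mod (L * v) p
      calc (L * u + q * ((L * v) / p)) * p + (L * v) % p * q
          = L * u * p + q * (p * ((L * v) / p) + (L * v) % p) := by ring
        _ = L * (u * p + v * q) := by rw [h1]; ring
        _ = L := by rw [huv, mul_one]
    · exact natDegree_mod_lt _ (by omega)
  have hLd : L.natDegree ≤ 1 := by
    rw [hL]
    refine natDegree_mul_le.trans ?_
    rw [natDegree_C, natDegree_X_sub_C]
  have had : a.natDegree ≤ Q.natDegree - 1 := by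
    by_cases ha : a = 0
    · rw [ha]; simp
    have h1 : a * p = L - b * q := by rw [← hab]; ring
    have h2 : (a * p).natDegree ≤ P.natDegree + Q.natDegree - 1 := by
      rw [h1]
      refine (natDegree_sub_le _ _).trans (max_le (hLd.trans (by omega)) ?_)
      refine natDegree_mul_le.trans ?_
      omega
    rw [natDegree_mul ha hp0] at h2
    omega
  obtain ⟨a0, ha0, ha1⟩ := round_poly a had
  obtain ⟨b0, hb0, hb1⟩ := round_poly b (k := P.natDegree - 1) (by omega)
  set R := a0 * P + b0 * Q with hR
  set da := a - a0.map (emb Fq) with hda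
  set db := b - b0.map (emb Fq) with hdb
  set E := da * p + db * q with hE
  have hRE : R.map (emb Fq) = L - E := by
    rw [hR, hE, hda, hdb, ← hab, Polynomial.map_add, Polynomial.map_mul, Polynomial.map_mul,
      ← hp, ← hq]
    ring
  have hEB : ∀ i, absK Fq (E.coeff i) ≤ H := by
    intro i
    rw [hE, coeff_add]
    refine absK_add_le_of ?_ ?_
    · simpa using absK_coeff_mul_le ha1 hpB i
    · simpa using absK_coeff_mul_le hb1 hqB i
  have hdad : da.natDegree ≤ h := (natDegree_sub_le _ _).trans
    (max_le (by omega) (by rw [natDegree_map_emb]; omega))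
  have hdbd : db.natDegree ≤ h := (natDegree_sub_le _ _).trans
    (max_le (by omega) (by rw [natDegree_map_emb]; omega))
  have hEd : E.natDegree ≤ 2 * h := by
    refine (natDegree_add_le _ _).trans (max_le ?_ ?_)
    · exact natDegree_mul_le.trans (by omega)
    · exact natDegree_mul_le.trans (by omega)
  have hEξ : absK Fq (E.eval ξ) ≤ mx ξ ^ h * ε := by
    rw [hE, eval_add, eval_mul, eval_mul]
    refine absK_add_le_of ?_ ?_
    · rw [absK_mul, hp, ← evalK_eq]
      have := absK_eval_le da ξ hdad ha1
      rw [one_mul] at this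
      exact mul_le_mul this hPε (absK_nonneg _) (by positivity)
    · rw [absK_mul, hq, ← evalK_eq]
      have := absK_eval_le db ξ hdbd hb1
      rw [one_mul] at this
      exact mul_le_mul this hQε (absK_nonneg _) (by positivity)
  have hE' : absK Fq ((derivative E).eval ξ) ≤ H * mx ξ ^ (2 * h) := by
    refine absK_eval_le _ ξ ((natDegree_derivative_le E).trans (by omega)) fun i => ?_
    rw [coeff_derivative, absK_mul]
    have h1 := absK_natCast_le (Fq := Fq) (i + 1)
    push_cast at h1
    calc _ ≤ H * 1 := mul_le_mul (hEB _) h1 (absK_nonneg _) (by linarith)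
      _ = H := mul_one _
  have hHA : H ≤ absK Fq A :=
    (le_mul_of_one_le_right (by linarith) (one_le_pow₀ hM1)).trans hA.le
  refine ⟨R, ?_, ?_, ?_, ?_⟩
  · refine (natDegree_add_le _ _).trans (max_le ?_ ?_)
    · exact natDegree_mul_le.trans (by omega)
    · exact natDegree_mul_le.trans (by omega)
  · rw [evalK_eq, hRE, eval_sub, hL]
    simp only [eval_mul, eval_C, eval_sub, eval_X, sub_self, mul_zero, zero_sub]
    rwa [absK_neg]
  · rw [evalK_eq, ← derivative_map, hRE, derivative_sub, eval_sub, hL]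
    simp only [derivative_mul, derivative_C, derivative_sub, derivative_X, sub_zero, zero_mul,
      zero_add, mul_one, eval_C]
    rw [sub_eq_add_neg]
    apply absK_add_eq_left
    rw [absK_neg]
    exact hE'.trans_lt hA
  · apply HP_le
    · nlinarith
    · intro i
      rw [← coeff_map, hRE, coeff_sub]
      have hAM : absK Fq A ≤ absK Fq A * mx ξ := le_mul_of_one_le_right (absK_nonneg _) hM1
      refine absK_sub_le_of ?_ ((hEB i).trans (hHA.trans hAM))
      rw [hL, coeff_C_mul, absK_mul]
      refine mul_le_mul_of_nonneg_left ?_ (absK_nonneg _)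
      rw [coeff_sub]
      refine absK_sub_le_of ?_ ?_
      · rw [coeff_X]; split_ifs
        · rw [absK_one]; exact hM1
        · rw [absK_zero]; linarith
      · rw [coeff_C]; split_ifs
        · exact absK_le_mx ξ
        · rw [absK_zero]; linarith

set_option linter.unusedSectionVars false

lemma GP_dirichlet {ξ : K Fq} (hξ : ¬ IsAlgK Fq ξ) {h : ℕ} {w : ℝ} (hw0 : 0 ≤ w) (hw : w < h) :
    GP ξ h w := by
  obtain ⟨C, hC, hD⟩ := dirichlet ξ h
  intro δ hδ
  obtain ⟨B, hB⟩ := exists_large (sub_pos.2 hw) (show 0 < δ / C by positivity)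
  obtain ⟨D, hBD⟩ := pow_unbounded_of_one_lt B (one_lt_q (Fq := Fq))
  obtain ⟨Q, q1, q2, q3, q4⟩ := hD D
  set Y := (Fintype.card Fq : ℝ) ^ D with hY
  have hY1 : 1 ≤ Y := one_le_pow₀ one_lt_q.le
  have hY0 : 0 < Y := by linarith
  have h1 := hB Y hY1 hBD
  have hQY : HP Fq Q ≤ Y := by
    rw [HP_eq]; exact pow_le_pow_right₀ one_lt_q.le q3
  refine ⟨Q, q2, absK_pos fun h0 => hξ ⟨Q, q1, h0⟩, ?_⟩
  have h2 : Y ^ (-w) ≤ HP Fq Q ^ (-w) :=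
    Real.rpow_le_rpow_of_nonpos (HP_pos Q) hQY (by linarith)
  refine lt_of_lt_of_le ?_ (mul_le_mul_of_nonneg_left h2 hδ.le)
  have h3 : absK Fq (evalK Fq Q ξ) ≤ C * Y ^ (-(h : ℝ)) := by
    rw [Real.rpow_neg hY0.le, Real.rpow_natCast, ← div_eq_mul_inv, le_div_iff₀ (by positivity)]
    exact q4
  have h4 : Y ^ (-(h : ℝ)) = Y ^ (-(h - w)) * Y ^ (-w) := by
    rw [← Real.rpow_add hY0]; ring_nf
  calc absK Fq (evalK Fq Q ξ) ≤ C * (Y ^ (-(h - w)) * Y ^ (-w)) := h4 ▸ h3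
    _ < C * (δ / C * Y ^ (-w)) := by gcongr
    _ = δ * Y ^ (-w) := by field_simp

set_option maxHeartbeats 2000000 in
lemma GS_trans {ξ : K Fq} (hξ : ¬ IsAlgK Fq ξ) {h : ℕ} (hh1 : 1 ≤ h) {w : ℝ} (hw0 : 0 ≤ w)
    (hw : w < h) : GS ξ (2 * h - 1) w := by
  obtain ⟨C, hC, hD⟩ := dirichlet ξ h
  have hGP := GP_dirichlet hξ hw0 hw
  intro δ hδ
  set M := mx ξ with hM
  have hM1 : 1 ≤ M := one_le_mx ξ
  have hM0 : 0 < M := mx_pos ξ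
  set q := (Fintype.card Fq : ℝ) with hq
  have hq1 : 1 < q := one_lt_q
  have hq0 : 0 < q := q_pos
  obtain ⟨e, he⟩ := pow_unbounded_of_one_lt (M ^ (2 * h)) hq1
  set κ : ℝ := (q ^ e * M) ^ (-w - 1) with hκ
  have hκ0 : 0 < κ := Real.rpow_pos_of_pos (by positivity) _
  have hqe1 : 1 ≤ q ^ e := one_le_pow₀ hq1.le
  -- the target smallness
  obtain ⟨δ1, hδ0, hδ1, hδ2, hδ3⟩ : ∃ δ1 : ℝ, 0 < δ1 ∧ δ1 < 1 ∧ δ1 * M ^ (3 * h + 1) ≤ 1 ∧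
      δ1 * M ^ h < δ * κ := by
    refine ⟨min (1 / (2 * M ^ (3 * h + 1))) (δ * κ / (2 * M ^ h)), by positivity, ?_, ?_, ?_⟩
    · refine (min_le_left _ _).trans_lt ?_
      rw [div_lt_one (by positivity)]
      have := one_le_pow₀ hM1 (n := 3 * h + 1)
      linarith
    · calc _ ≤ 1 / (2 * M ^ (3 * h + 1)) * M ^ (3 * h + 1) := by gcongr; exact min_le_left _ _
        _ = 1 / 2 := by field_simp
        _ ≤ 1 := by norm_num
    · calc _ ≤ δ * κ / (2 * M ^ h) * M ^ h := by gcongr; exact min_le_right _ _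
        _ = δ * κ / 2 := by field_simp
        _ < δ * κ := by linarith [mul_pos hδ hκ0]
  obtain ⟨B, hB⟩ := exists_large (sub_pos.2 hw) (show 0 < δ1 / (C * q ^ h) by positivity)
  obtain ⟨ρ, hρ0, hρ1, hρ⟩ := exists_lower
    ((finite_HP_le (Fq := Fq) h (max B 1)).subset
      (Set.sep_subset _ (fun P => 0 < absK Fq (evalK Fq P ξ))))
    (fun P => absK Fq (evalK Fq P ξ)) (fun P hP => hP.2)
  set δ2 := min δ1 ρ with hδ2'
  have hδ20 : 0 < δ2 := lt_min hδ0 hρ0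
  have hδ21 : δ2 ≤ 1 := (min_le_left _ _).trans hδ1.le
  obtain ⟨P0, p1, p2, p3⟩ := hGP (δ2 ^ h) (by positivity)
  obtain ⟨P, r1, r2, r3, r4, r5⟩ := exists_factor hw0 hδ20 p2
    (p3.trans_le (mul_le_mul_of_nonneg_right (pow_le_pow_of_le_one hδ20.le hδ21 p1)
      (Real.rpow_nonneg (HP_pos P0).le _)))
  have hPh : P.natDegree ≤ h := r3.trans p1
  have r6 : absK Fq (evalK Fq P ξ) < δ2 * HP Fq P ^ (-w) := by
    refine r5.trans_le (mul_le_mul_of_nonneg_right ?_ (Real.rpow_nonneg (HP_pos P).le _))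
    calc δ2 ^ P.natDegree ≤ δ2 ^ 1 := pow_le_pow_of_le_one hδ20.le hδ21 r2
      _ = δ2 := pow_one _
  have hlarge : max B 1 < HP Fq P := by
    by_contra hc
    have h1 := hρ P ⟨⟨hPh, not_lt.1 hc⟩, r4⟩
    have h2 : δ2 * HP Fq P ^ (-w) ≤ ρ :=
      (mul_le_of_le_one_right hδ20.le (HP_rpow_le_one P hw0)).trans (min_le_right _ _)
    linarith
  set H := HP Fq P with hH
  have hHB : B < H := (le_max_left _ _).trans_lt hlarge
  have hH1 : 1 < H := (le_max_right _ _).trans_lt hlarge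
  have hH0 : 0 < H := by linarith
  have hHq : H = q ^ hh P := HP_eq P
  have hhP : 0 < hh P := by
    rcases Nat.eq_zero_or_pos (hh P) with h0 | h0
    · rw [h0, pow_zero] at hHq; linarith
    · exact h0
  obtain ⟨Q, q1, q2, q3, q4⟩ := hD (hh P - 1)
  set Y := q ^ (hh P - 1) with hY
  have hYH : Y * q = H := by
    rw [hHq, hY, ← pow_succ]; congr 1; omega
  have hY0 : 0 < Y := by positivity
  have hQY : HP Fq Q ≤ Y := by
    rw [HP_eq]; exact pow_le_pow_right₀ hq1.le q3
  have hYltH : Y < H := by rw [← hYH]; exact lt_mul_of_one_lt_right hY0 hq1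
  have hnd : ¬ P ∣ Q := fun hd => absurd (HP_le_of_dvd q1 hd) (not_le.2 (hQY.trans_lt hYltH))
  have hQ1 : absK Fq (evalK Fq Q ξ) ≤ δ1 * H ^ (-w) := by
    have h1 : absK Fq (evalK Fq Q ξ) * H ^ h ≤ C * q ^ h := by
      rw [← hYH, mul_pow, ← mul_assoc]
      gcongr
    have h3 : absK Fq (evalK Fq Q ξ) ≤ C * q ^ h * H ^ (-(h : ℝ)) := by
      rw [Real.rpow_neg hH0.le, Real.rpow_natCast, ← div_eq_mul_inv, le_div_iff₀ (by positivity)]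
      exact h1
    have h4 : H ^ (-(h : ℝ)) = H ^ (-(h - w)) * H ^ (-w) := by
      rw [← Real.rpow_add hH0]; ring_nf
    calc absK Fq (evalK Fq Q ξ) ≤ C * q ^ h * (H ^ (-(h - w)) * H ^ (-w)) := h4 ▸ h3
      _ ≤ C * q ^ h * (δ1 / (C * q ^ h) * H ^ (-w)) := by
          have := (hB H hH1.le hHB).le
          gcongr
      _ = δ1 * H ^ (-w) := by field_simp
  have hHw1 : H ^ (-w) ≤ 1 := HP_rpow_le_one P hw0
  have hHw0 : 0 < H ^ (-w) := Real.rpow_pos_of_pos hH0 _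
  have hP1 : absK Fq (evalK Fq P ξ) ≤ δ1 * H ^ (-w) :=
    r6.le.trans (mul_le_mul_of_nonneg_right (min_le_left _ _) hHw0.le)
  have hQd : 0 < Q.natDegree := by
    rcases Nat.eq_zero_or_pos Q.natDegree with h0 | h0
    · exfalso
      have h1 := one_le_absK_eval_of_natDegree_zero (ξ := ξ) h0
        (absK_pos fun h0 => hξ ⟨Q, q1, h0⟩)
      have h2 : δ1 * H ^ (-w) ≤ δ1 := mul_le_of_le_one_right hδ0.le hHw1
      linarith
    · exact h0
  have hAabs : absK Fq (Tvar Fq ^ (e + hh P)) = q ^ e * H := by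
    rw [absK_pow, absK_Tvar, pow_add, ← hHq]
  obtain ⟨R, t1, t2, t3, t4⟩ := combine (coprime_of_not_dvd r1 r2 hnd) r2 hQd hPh q2 (le_refl H)
    (hQY.trans hYltH.le) hP1 hQ1 (A := Tvar Fq ^ (e + hh P)) (by
      rw [hAabs, mul_comm]
      gcongr)
  rw [hAabs] at t3 t4
  set Z := q ^ e * H with hZ
  have hZ1 : 1 < Z := by nlinarith
  have hR0 : R ≠ 0 := by
    rintro rfl
    rw [derivative_zero, evalK_zero, absK_zero] at t3
    linarith
  have hRξ : 0 < absK Fq (evalK Fq R ξ) := absK_pos fun h0 => hξ ⟨R, hR0, h0⟩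
  obtain ⟨α, a1, a2, a3, a4, a5⟩ := hensel_alg (ξ := ξ) t1 (by
    rw [t3]
    have e1 : M ^ (2 * h - 1) ≤ M ^ (2 * h) := pow_le_pow_right₀ hM1 (by omega)
    have hHPR := HP_pos R
    calc absK Fq (evalK Fq R ξ) * (HP Fq R * M ^ (2 * h - 1))
        ≤ (M ^ h * (δ1 * H ^ (-w))) * (Z * M * M ^ (2 * h)) := by gcongr
      _ = (δ1 * M ^ (3 * h + 1)) * H ^ (-w) * Z := by ring
      _ ≤ 1 * 1 * Z := by gcongr
      _ < Z ^ 2 := by nlinarith) hRξ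
  refine ⟨α, a1, a2, a3, lt_of_le_of_lt a5 ?_⟩
  have hHA := one_le_HA a1
  have h4 : (Z * M) ^ (-w - 1) ≤ HA Fq α ^ (-w - 1) :=
    Real.rpow_le_rpow_of_nonpos (by linarith) (a4.trans t4) (by linarith)
  refine lt_of_lt_of_le ?_ (mul_le_mul_of_nonneg_left h4 hδ.le)
  have h5 : (Z * M) ^ (-w - 1) = κ * (H ^ (-w) / H) := by
    have : Z * M = (q ^ e * M) * H := by rw [hZ]; ring
    rw [this, Real.mul_rpow (by positivity) hH0.le, Real.rpow_sub hH0 (-w) 1, Real.rpow_one]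
  rw [h5, t3]
  calc absK Fq (evalK Fq R ξ) / Z ≤ (M ^ h * (δ1 * H ^ (-w))) / Z := by gcongr
    _ ≤ (M ^ h * (δ1 * H ^ (-w))) / H := by
        gcongr
        exact le_mul_of_one_le_left hH0.le hqe1
    _ = δ1 * M ^ h * (H ^ (-w) / H) := by ring
    _ < δ * κ * (H ^ (-w) / H) := by gcongr
    _ = δ * (κ * (H ^ (-w) / H)) := by ring

set_option linter.unusedSectionVars false
/-! ### Comparison of the limits -/

lemma coe_lt_mul_inv {n : ℕ} (hn : 1 ≤ n) (x : EReal) (c : ℝ) :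
    (c : EReal) < x * (((n : ℝ)⁻¹ : ℝ) : EReal) ↔ ((c * n : ℝ) : EReal) < x := by
  have hn0 : (0 : ℝ) < n := by exact_mod_cast hn
  have hi : (0 : ℝ) < (n : ℝ)⁻¹ := inv_pos.2 hn0
  induction x with
  | bot => rw [EReal.bot_mul_coe_of_pos hi]; simp
  | top => rw [EReal.top_mul_coe_of_pos hi]; exact iff_of_true (EReal.coe_lt_top _) (EReal.coe_lt_top _)
  | coe x =>
    rw [← EReal.coe_mul, EReal.coe_lt_coe_iff, EReal.coe_lt_coe_iff, ← div_eq_mul_inv,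
      lt_div_iff₀ hn0]

lemma coe_le_mul_inv {n : ℕ} (hn : 1 ≤ n) {x : EReal} {c : ℝ}
    (h : ((c * n : ℝ) : EReal) ≤ x) : (c : EReal) ≤ x * (((n : ℝ)⁻¹ : ℝ) : EReal) := by
  have hn0 : (0 : ℝ) < n := by exact_mod_cast hn
  have hi : (0 : ℝ) < (n : ℝ)⁻¹ := inv_pos.2 hn0
  induction x with
  | bot => exact absurd h (not_le.2 (EReal.bot_lt_coe _))
  | top => rw [EReal.top_mul_coe_of_pos hi]; exact le_top
  | coe x =>
    rw [EReal.coe_le_coe_iff] at h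
    rw [← EReal.coe_mul, EReal.coe_le_coe_iff, ← div_eq_mul_inv, le_div_iff₀ hn0]
    exact h

lemma mul_inv_le_coe {n : ℕ} {x : EReal} {d : ℝ} (hn : 1 ≤ n)
    (h : x ≤ (d : EReal)) : x * (((n : ℝ)⁻¹ : ℝ) : EReal) ≤ ((d * (n : ℝ)⁻¹ : ℝ) : EReal) := by
  have hn0 : (0 : ℝ) < n := by exact_mod_cast hn
  have hi : (0 : ℝ) < (n : ℝ)⁻¹ := inv_pos.2 hn0
  induction x with
  | bot => rw [EReal.bot_mul_coe_of_pos hi]; exact bot_le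
  | top => simp at h
  | coe x =>
    rw [EReal.coe_le_coe_iff] at h
    rw [← EReal.coe_mul, EReal.coe_le_coe_iff]
    gcongr

lemma limsup_const (d : ℝ) :
    Filter.atTop.limsup (fun n : ℕ => ((d * (n : ℝ)⁻¹ : ℝ) : EReal)) = 0 := by
  apply Filter.Tendsto.limsup_eq
  have h1 : Filter.Tendsto (fun n : ℕ => d * (n : ℝ)⁻¹) Filter.atTop (nhds 0) := by
    have := (tendsto_inv_atTop_nhds_zero_nat (𝕜 := ℝ)).const_mul d
    rwa [mul_zero] at this
  exact (continuous_coe_real_ereal.tendsto 0).comp h1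

lemma neg_two_le_wn (ξ : K Fq) (n : ℕ) : (((-2 : ℝ)) : EReal) ≤ wn Fq ξ n := by
  refine le_sSup ⟨-2, ?_, rfl⟩
  have hinj : Function.Injective (fun k : ℕ => (C (X ^ (k + 1)) : Fq[X][X])) := by
    intro a b hab
    have h1 := C_injective hab
    have h2 := congrArg natDegree h1
    simpa using h2
  refine (Set.infinite_range_of_injective hinj).mono ?_
  rintro _ ⟨k, rfl⟩
  have hq1 := one_lt_q (Fq := Fq)
  have he : absK Fq (emb Fq (X ^ (k + 1))) = (Fintype.card Fq : ℝ) ^ (k + 1) := by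
    rw [map_pow, emb_X, absK_pow, absK_Tvar]
  have h1 := absK_coeff_le (C (X ^ (k + 1)) : Fq[X][X]) 0
  rw [coeff_C_zero, he] at h1
  have h2 : 1 < (Fintype.card Fq : ℝ) ^ (k + 1) := one_lt_pow₀ hq1 (by omega)
  refine ⟨by simp, ?_, ?_⟩
  · simp only [evalK_C]
    rw [he]; linarith
  · simp only [evalK_C]
    rw [he, neg_neg]
    have : HP Fq (C (X ^ (k + 1)) : Fq[X][X]) ^ (2 : ℝ) = HP Fq (C (X ^ (k + 1)) : Fq[X][X]) ^ 2 := by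
      exact_mod_cast Real.rpow_natCast _ 2
    rw [this]
    nlinarith

lemma neg_two_le_wnstar (ξ : K Fq) {n : ℕ} (hn : 1 ≤ n) :
    (((-2 : ℝ)) : EReal) ≤ wnstar Fq ξ n := by
  refine le_sSup ⟨-2, ?_, rfl⟩
  have hq1 := one_lt_q (Fq := Fq)
  have hT : Tvar Fq ≠ 0 := by
    rw [← absK_pos_iff, absK_Tvar]; exact q_pos
  have hinj : Function.Injective (fun k : ℕ => (Tvar Fq ^ k)⁻¹) := by
    intro a b hab
    have h1 : absK Fq (Tvar Fq ^ a) = absK Fq (Tvar Fq ^ b) := by rw [inv_injective hab]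
    rw [absK_pow, absK_pow, absK_Tvar] at h1
    exact pow_right_injective₀ q_pos hq1.ne' h1
  refine (((Set.infinite_range_of_injective hinj).sdiff
    (finite_HA_le (Fq := Fq) n (mx ξ))).sdiff (Set.finite_singleton ξ)).mono ?_
  rintro _ ⟨⟨⟨k, rfl⟩, h2⟩, h3⟩
  simp only [] at h2 h3
  have hPe : evalK Fq (C (X ^ k) * X - 1) (Tvar Fq ^ k)⁻¹ = 0 := by
    unfold evalK
    rw [eval₂_sub, eval₂_mul, eval₂_C, eval₂_X, eval₂_one, map_pow, emb_X,
      mul_inv_cancel₀ (pow_ne_zero _ hT), sub_self]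
  have hP0 : (C (X ^ k) * X - 1 : Fq[X][X]) ≠ 0 := by
    intro h0
    have := congrArg (fun P => coeff P 0) h0
    simp at this
  have hPd : (C (X ^ k) * X - 1 : Fq[X][X]).natDegree ≤ n := by
    refine ((natDegree_sub_le _ _).trans (max_le ?_ ?_)).trans hn
    · exact natDegree_mul_le.trans (by simp)
    · simp
  have halg : IsAlgK Fq (Tvar Fq ^ k)⁻¹ := ⟨_, hP0, hPe⟩
  have hdeg : degA Fq (Tvar Fq ^ k)⁻¹ ≤ n := (degA_le hP0 hPe).trans hPd
  have hHA : mx ξ < HA Fq (Tvar Fq ^ k)⁻¹ := by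
    by_contra hc
    exact h2 ⟨halg, hdeg, not_lt.1 hc⟩
  refine ⟨halg, hdeg, absK_pos (sub_ne_zero.2 fun h => h3 h.symm), ?_⟩
  have e : (- -2 - 1 : ℝ) = 1 := by norm_num
  rw [e, Real.rpow_one]
  refine lt_of_le_of_lt (absK_sub_le_of (absK_le_mx ξ) ?_) hHA
  rw [absK_inv, absK_pow, absK_Tvar]
  exact (inv_le_one_of_one_le₀ (one_le_pow₀ hq1.le)).trans (one_le_mx ξ)

lemma wlim_nonneg (ξ : K Fq) : 0 ≤ wlim Fq ξ := by
  rw [← limsup_const (-2)]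
  refine Filter.limsup_le_limsup ?_
  filter_upwards [Filter.eventually_ge_atTop 1] with n hn
  have hn0 : (0 : ℝ) < n := by exact_mod_cast hn
  refine coe_le_mul_inv hn ?_
  rw [inv_mul_cancel_right₀ hn0.ne']
  exact neg_two_le_wn ξ n

lemma wlimstar_nonneg (ξ : K Fq) : 0 ≤ wlimstar Fq ξ := by
  rw [← limsup_const (-2)]
  refine Filter.limsup_le_limsup ?_
  filter_upwards [Filter.eventually_ge_atTop 1] with n hn
  have hn0 : (0 : ℝ) < n := by exact_mod_cast hn
  refine coe_le_mul_inv hn ?_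
  rw [inv_mul_cancel_right₀ hn0.ne']
  exact neg_two_le_wnstar ξ hn

lemma wlimstar_le (ξ : K Fq) : wlimstar Fq ξ ≤ wlim Fq ξ := by
  by_contra hc
  obtain ⟨c, hc1, hc2⟩ := EReal.lt_iff_exists_real_btwn.1 (not_le.1 hc)
  have hc0 : 0 ≤ c := by
    have := (wlim_nonneg ξ).trans hc1.le
    exact_mod_cast this
  have hf := (Filter.frequently_lt_of_lt_limsup (by isBoundedDefault) hc2).and_eventually
    (Filter.eventually_ge_atTop 1)
  refine absurd ?_ (not_le.2 hc1)
  refine Filter.le_limsup_of_frequently_le (hf.mono ?_) (by isBoundedDefault)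
  rintro n ⟨h1, h2⟩
  rw [coe_lt_mul_inv h2] at h1
  have h3 : 0 ≤ c * n := by positivity
  exact coe_le_mul_inv h2 (le_wn h3 (GP_of_GS h3 (GS_of_lt h1)))

lemma wlimstar_top {ξ : K Fq} (h : wlim Fq ξ = ⊤) : wlimstar Fq ξ = ⊤ := by
  rw [EReal.eq_top_iff_forall_lt]
  intro y
  set M := max y 0 + 1 with hM
  have hM0 : 0 ≤ M := by positivity
  have hyM : y < M := by linarith [le_max_left y 0]
  refine lt_of_lt_of_le (EReal.coe_lt_coe_iff.2 hyM) ?_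
  have h0 : ((M + 10 : ℝ) : EReal) < wlim Fq ξ := by rw [h]; exact EReal.coe_lt_top _
  have hf := (Filter.frequently_lt_of_lt_limsup (by isBoundedDefault) h0).and_eventually
    (Filter.eventually_ge_atTop 1)
  refine Filter.le_limsup_of_frequently_le (hf.mono ?_) (by isBoundedDefault)
  rintro n ⟨h1, h2⟩
  rw [coe_lt_mul_inv h2] at h1
  have hn1 : (1 : ℝ) ≤ n := by exact_mod_cast h2
  have h3 : 0 ≤ M * n := by positivity
  refine coe_le_mul_inv h2 ?_
  refine le_trans ?_ (le_wnstar ?_ (GS_of_GP h2 (by linarith) (GP_of_lt h1)))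
  · rw [EReal.coe_le_coe_iff]; linarith
  · linarith

lemma wlimstar_pos {ξ : K Fq} (h : 0 < wlim Fq ξ) : 0 < wlimstar Fq ξ := by
  have hξ : ¬ IsAlgK Fq ξ := by
    intro ha
    obtain ⟨d, hd⟩ := liouville ha
    refine absurd h (not_lt.2 ?_)
    rw [← limsup_const d]
    refine Filter.limsup_le_limsup ?_
    filter_upwards [Filter.eventually_ge_atTop 1] with n hn
    exact mul_inv_le_coe hn (hd n)
  have hhalf : (0 : EReal) < ((1 / 2 : ℝ) : EReal) := by
    exact_mod_cast (by norm_num : (0 : ℝ) < 1 / 2)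
  refine lt_of_lt_of_le hhalf ?_
  refine Filter.le_limsup_of_frequently_le ?_ (by isBoundedDefault)
  rw [Filter.frequently_atTop]
  intro a
  refine ⟨2 * (a + 1) - 1, by omega, ?_⟩
  refine coe_le_mul_inv (by omega) ?_
  have ha0 : (0 : ℝ) ≤ a := Nat.cast_nonneg a
  have hcast : (1 / 2 : ℝ) * ((2 * (a + 1) - 1 : ℕ) : ℝ) = a + 1 / 2 := by
    have : 2 * (a + 1) - 1 = 2 * a + 1 := by omega
    rw [this]; push_cast; ring
  rw [hcast]
  exact le_wnstar (by linarith)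
    (GS_trans hξ (h := a + 1) (by omega) (by linarith) (by push_cast; linarith))

lemma wn_top_iff (ξ : K Fq) {n : ℕ} (hn : 1 ≤ n) : wn Fq ξ n = ⊤ ↔ wnstar Fq ξ n = ⊤ := by
  have hn1 : (1 : ℝ) ≤ n := by exact_mod_cast hn
  constructor
  · intro h
    rw [EReal.eq_top_iff_forall_lt]
    intro y
    have hy := le_max_left y 0
    have hy0 := le_max_right y 0
    have h1 : ((max y 0 + 10 * n : ℝ) : EReal) < wn Fq ξ n := by
      rw [h]; exact EReal.coe_lt_top _
    refine lt_of_lt_of_le ?_ (le_wnstar ?_ (GS_of_GP hn (by linarith) (GP_of_lt h1)))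
    · rw [EReal.coe_lt_coe_iff]; linarith
    · linarith
  · intro h
    rw [EReal.eq_top_iff_forall_lt]
    intro y
    have hy := le_max_left y 0
    have hy0 := le_max_right y 0
    have h1 : ((max y 0 + 1 : ℝ) : EReal) < wnstar Fq ξ n := by
      rw [h]; exact EReal.coe_lt_top _
    have h2 : 0 ≤ max y 0 + 1 := by linarith
    refine lt_of_lt_of_le ?_ (le_wn h2 (GP_of_GS h2 (GS_of_lt h1)))
    rw [EReal.coe_lt_coe_iff]; linarith

lemma main_proof (ξ : K Fq) :
    (∀ n : ℕ, 1 ≤ n → (wn Fq ξ n = ⊤ ↔ wnstar Fq ξ n = ⊤)) ∧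
    (wlim Fq ξ = 0 ↔ wlimstar Fq ξ = 0) ∧
    ((0 < wlim Fq ξ ∧ wlim Fq ξ < ⊤) ↔ (0 < wlimstar Fq ξ ∧ wlimstar Fq ξ < ⊤)) ∧
    (wlim Fq ξ = ⊤ ↔ wlimstar Fq ξ = ⊤) := by
  have h1 := wlim_nonneg ξ
  have h2 := wlimstar_nonneg ξ
  have h3 := wlimstar_le ξ
  have hpos : 0 < wlim Fq ξ ↔ 0 < wlimstar Fq ξ := ⟨wlimstar_pos, fun h => h.trans_le h3⟩
  have htop : wlim Fq ξ = ⊤ ↔ wlimstar Fq ξ = ⊤ :=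
    ⟨wlimstar_top, fun h => top_le_iff.1 (h ▸ h3)⟩
  refine ⟨fun n hn => wn_top_iff ξ hn, ?_, ?_, htop⟩
  · rw [← not_iff_not, ← ne_eq, ← ne_eq, ← h1.lt_iff_ne', ← h2.lt_iff_ne']
    exact hpos
  · rw [hpos, lt_top_iff_ne_top, lt_top_iff_ne_top, ne_eq, ne_eq, htop]

end

/-- Mahler's and Koksma's classifications coincide in `F_q((T⁻¹))`:
for every `n ≥ 1`, `w_n(ξ)` is finite iff `w_n^*(ξ)` is finite, and
`w(ξ) = limsup w_n(ξ)/n` is zero (resp. positive finite, resp. infinite)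
exactly when `w^*(ξ) = limsup w_n^*(ξ)/n` is. -/
theorem classifications_coincide (Fq : Type) [Field Fq] [Fintype Fq] (ξ : K Fq) :
    (∀ n : ℕ, 1 ≤ n → (wn Fq ξ n = ⊤ ↔ wnstar Fq ξ n = ⊤)) ∧
    (wlim Fq ξ = 0 ↔ wlimstar Fq ξ = 0) ∧
    ((0 < wlim Fq ξ ∧ wlim Fq ξ < ⊤) ↔ (0 < wlimstar Fq ξ ∧ wlimstar Fq ξ < ⊤)) ∧
    (wlim Fq ξ = ⊤ ↔ wlimstar Fq ξ = ⊤) := by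
  exact main_proof ξ

end
end MahlerKoksmaFq
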